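/- Let T⁺ ⊆ S¹ × S¹ × S¹ denote the subspace of positively oriented triples. The map Φ_tr : T⁺ → flags defined by Φ_tr(x,y,z) = (ℙ((x¹ + z¹) ∩ ξ²(y)), x¹ + z¹) is well defined (the subspace (x¹ + z¹) ∩ ξ²(y) is 1-dimensional and the resulting flag lies in Ω²), its image is exactly Ω², and Φ_tr is a two-sheeted covering map onto Ω². -/

import Mathlib

noncomputable section

open Filter Topology Module
open scoped LinearAlgebra.Projectivization

namespace CFF

instance {K V : Type*} [DivisionRing K] [AddCommGroup V] [Module K V] [TopologicalSpace V] :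
    TopologicalSpace (ℙ K V) :=
  inferInstanceAs (TopologicalSpace (Quotient (projectivizationSetoid K V)))

instance : TopologicalSpace (Module.Dual ℝ (Fin 3 → ℝ)) :=
  TopologicalSpace.induced (LinearEquiv.piRing ℝ ℝ (Fin 3) ℝ) inferInstance

/-- The projective line in `ℙ(ℝ³)` determined by a plane `W ≤ ℝ³`. -/
def projLine (W : Submodule ℝ (Fin 3 → ℝ)) : Set (ℙ ℝ (Fin 3 → ℝ)) :=
  {p | p.submodule ≤ W}

/-- `C ⊆ ℙ(ℝ³)` is properly convex: there is a linear functional `f` nonzero on every nonzero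
vector spanning a point of the closure of `C`, such that the image of `C` in the affine chart
`{[v] : f v = 1}` is convex. -/
def ProperlyConvex (C : Set (ℙ ℝ (Fin 3 → ℝ))) : Prop :=
  ∃ f : (Fin 3 → ℝ) →ₗ[ℝ] ℝ,
    (∀ (v : Fin 3 → ℝ) (hv : v ≠ 0), Projectivization.mk ℝ v hv ∈ closure C → f v ≠ 0) ∧
    Convex ℝ {w : Fin 3 → ℝ | f w = 1 ∧ ∃ hw : w ≠ 0, Projectivization.mk ℝ w hw ∈ C}

/-- The frontier of `C` contains no three distinct collinear points. -/
def StrictlyConvexBoundary (C : Set (ℙ ℝ (Fin 3 → ℝ))) : Prop :=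
  ∀ p q r : ℙ ℝ (Fin 3 → ℝ), p ∈ frontier C → q ∈ frontier C → r ∈ frontier C →
    p ≠ q → p ≠ r → q ≠ r →
    ∀ W : Submodule ℝ (Fin 3 → ℝ), finrank ℝ W = 2 →
      ¬ (p.submodule ≤ W ∧ q.submodule ≤ W ∧ r.submodule ≤ W)

/-- `W` determines a supporting line of `C` at the frontier point `p`: a projective line
containing `p` and disjoint from `C`. -/
def IsSupportingLineAt (C : Set (ℙ ℝ (Fin 3 → ℝ))) (W : Submodule ℝ (Fin 3 → ℝ))
    (p : ℙ ℝ (Fin 3 → ℝ)) : Prop :=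
  finrank ℝ W = 2 ∧ p ∈ frontier C ∧ p.submodule ≤ W ∧ projLine W ∩ C = ∅

/-- `(x, y, z)` is a positively oriented triple on the circle: `y` and `z` occur in that order
when traversing the circle counterclockwise starting from `x`.  (This implies the three points
are pairwise distinct.) -/
def PosOriented (x y z : Circle) : Prop :=
  ∃ a b c : ℝ, Circle.exp a = x ∧ Circle.exp b = y ∧ Circle.exp c = z ∧
    a < b ∧ b < c ∧ c < a + 2 * Real.pi

/-- The space of flags `(p, l)`, realized inside `ℙ(ℝ³) × ℙ((ℝ³)*)`: the pair `(p, φ)`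
represents the flag whose line is the plane annihilated by `φ`, and `p` must lie on it. -/
def Flags : Set (ℙ ℝ (Fin 3 → ℝ) × ℙ ℝ (Module.Dual ℝ (Fin 3 → ℝ))) :=
  {pl | pl.1.submodule ≤ pl.2.submodule.dualCoannihilator}

/-- The flags `(p, l)` with `p` outside the closure of `C` and `ℙ(l)` meeting `C`. -/
def Omega2 (C : Set (ℙ ℝ (Fin 3 → ℝ))) :
    Set (ℙ ℝ (Fin 3 → ℝ) × ℙ ℝ (Module.Dual ℝ (Fin 3 → ℝ))) :=
  {pl | pl ∈ Flags ∧ pl.1 ∉ closure C ∧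
    ∃ q ∈ C, q.submodule ≤ pl.2.submodule.dualCoannihilator}


section Part1

theorem covering_aux {E X : Type*} [TopologicalSpace E] [TopologicalSpace X] {f : E → X}
    (hc : Continuous f) (hcl : IsClosedMap f) (h2 : ∀ b, (f ⁻¹' {b}).ncard = 2)
    (hV : ∀ b, ∃ V₁ V₂ : Set E, IsOpen V₁ ∧ IsOpen V₂ ∧ Disjoint V₁ V₂ ∧
      f ⁻¹' {b} ⊆ V₁ ∪ V₂ ∧ Set.InjOn f V₁ ∧ Set.InjOn f V₂) : IsCoveringMap f := by
  classical
  intro b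
  obtain ⟨V₁, V₂, o1, o2, hd, hsub, i1, i2⟩ := hV b
  suffices h : IsEvenlyCovered f b Bool from h.to_isEvenlyCovered_preimage
  set U : Set X := (f '' (V₁ ∪ V₂)ᶜ)ᶜ with hU
  have hUo : IsOpen U := (hcl _ (o1.union o2).isClosed_compl).isOpen_compl
  have hbU : b ∈ U := by
    rintro ⟨e, he, rfl⟩
    exact he (hsub rfl)
  have hUV : ∀ e, f e ∈ U → e ∈ V₁ ∪ V₂ := by
    intro e he
    by_contra hne
    exact he ⟨e, hne, rfl⟩
  refine ⟨inferInstance, U, hbU, hUo, hUo.preimage hc, ?_⟩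
  let g : f ⁻¹' U → U × Bool := fun e => (⟨f e.1, e.2⟩, decide (e.1 ∈ V₁))
  have hdec : Continuous (fun e : f ⁻¹' U => decide (e.1 ∈ V₁)) := by
    rw [continuous_discrete_rng]
    intro i
    cases i
    · have : (fun e : f ⁻¹' U => decide (e.1 ∈ V₁)) ⁻¹' {false} = Subtype.val ⁻¹' V₂ := by
        ext e
        have := hUV e.1 e.2
        have h3 : e.1 ∈ V₁ → e.1 ∉ V₂ := fun h h' => Set.disjoint_left.1 hd h h'
        simp only [Set.mem_preimage, Set.mem_singleton_iff, decide_eq_false_iff_not]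
        constructor
        · intro h; exact this.resolve_left h
        · intro h h'; exact h3 h' h
      rw [this]; exact o2.preimage continuous_subtype_val
    · have : (fun e : f ⁻¹' U => decide (e.1 ∈ V₁)) ⁻¹' {true} = Subtype.val ⁻¹' V₁ := by
        ext e; simp
      rw [this]; exact o1.preimage continuous_subtype_val
  have hgc : Continuous g := by
    refine Continuous.prodMk ?_ hdec
    exact (hc.comp continuous_subtype_val).subtype_mk _
  have hinj : Function.Injective g := by
    rintro ⟨e, he⟩ ⟨e', he'⟩ h
    simp only [g, Prod.mk.injEq, Subtype.mk.injEq, decide_eq_decide] at h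
    obtain ⟨h1, h3⟩ := h
    apply Subtype.ext
    by_cases hm : e ∈ V₁
    · exact i1 hm (h3.1 hm) h1
    · exact i2 ((hUV e he).resolve_left hm)
        ((hUV e' he').resolve_left (fun h => hm (h3.2 h))) h1
  have hsurj : Function.Surjective g := by
    rintro ⟨⟨u, hu⟩, i⟩
    obtain ⟨e, e', hne, hee⟩ := Set.ncard_eq_two.1 (h2 u)
    have he : f e = u := by
      have : e ∈ f ⁻¹' {u} := by rw [hee]; simp
      exact this
    have he' : f e' = u := by
      have : e' ∈ f ⁻¹' {u} := by rw [hee]; simp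
      exact this
    have m := hUV e (by rw [he]; exact hu)
    have m' := hUV e' (by rw [he']; exact hu)
    have key : ∃ w, f w = u ∧ decide (w ∈ V₁) = i := by
      have n1 : ¬ (e ∈ V₁ ∧ e' ∈ V₁) := fun h => hne (i1 h.1 h.2 (he.trans he'.symm))
      have n2 : ¬ (e ∈ V₂ ∧ e' ∈ V₂) := fun h => hne (i2 h.1 h.2 (he.trans he'.symm))
      have d1 : e ∈ V₁ → e ∉ V₂ := fun h h' => Set.disjoint_left.1 hd h h'
      simp only [Set.mem_union] at m m'
      by_cases hm : e ∈ V₁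
      · have hm' : e' ∉ V₁ := fun h => n1 ⟨hm, h⟩
        cases i
        · exact ⟨e', he', by simpa using hm'⟩
        · exact ⟨e, he, by simpa using hm⟩
      · have hm' : e' ∈ V₁ := by tauto
        cases i
        · exact ⟨e, he, by simpa using hm⟩
        · exact ⟨e', he', by simpa using hm'⟩
    obtain ⟨w, hw, hwi⟩ := key
    refine ⟨⟨w, by rw [Set.mem_preimage, hw]; exact hu⟩, ?_⟩
    simp only [g, Prod.mk.injEq, Subtype.mk.injEq]
    exact ⟨hw, hwi⟩
  have hgcl : IsClosedMap g := by
    intro S hS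
    have hr := hcl.restrictPreimage U
    have : g '' S = ⋃ i : Bool, ((U.restrictPreimage f) ''
        (S ∩ (fun e : f ⁻¹' U => decide (e.1 ∈ V₁)) ⁻¹' {i})) ×ˢ {i} := by
      ext ⟨u, i⟩
      simp only [Set.mem_image, Set.mem_iUnion, Set.mem_prod, Set.mem_singleton_iff,
        Set.mem_inter_iff, Set.mem_preimage]
      constructor
      · rintro ⟨e, he, h⟩
        simp only [g, Prod.mk.injEq] at h
        exact ⟨i, ⟨e, ⟨he, h.2⟩, h.1⟩, rfl⟩
      · rintro ⟨j, ⟨e, ⟨he, h⟩, h'⟩, rfl⟩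
        exact ⟨e, he, Prod.ext h' h⟩
    rw [this]
    refine isClosed_iUnion_of_finite fun i => ?_
    refine IsClosed.prod (hr _ (hS.inter ?_)) isClosed_singleton
    exact isClosed_singleton.preimage hdec
  refine ⟨(Equiv.ofBijective g ⟨hinj, hsurj⟩).toHomeomorphOfContinuousClosed hgc hgcl, ?_⟩
  intro x
  rfl

theorem exp_lift (a : ℝ) (z : Circle) (h : Circle.exp a ≠ z) :
    ∃ c, Circle.exp c = z ∧ a < c ∧ c < a + 2 * Real.pi := by
  have hp := Real.two_pi_pos
  have hm := toIcoMod_mem_Ico hp a (Complex.arg z)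
  have he : Circle.exp (toIcoMod hp a (Complex.arg z)) = z := by
    rw [toIcoMod, Circle.exp_sub, zsmul_eq_mul, Circle.exp_int_mul_two_pi, div_one, Circle.exp_arg]
  refine ⟨_, he, lt_of_le_of_ne hm.1 ?_, hm.2⟩
  intro h'
  rw [← h'] at he
  exact h he

theorem pos_tri {x y z : Circle} (h1 : x ≠ y) (h2 : y ≠ z) (h3 : x ≠ z) :
    PosOriented x y z ∨ PosOriented x z y := by
  have ha := Circle.exp_arg x
  obtain ⟨b, hb, hb1, hb2⟩ := exp_lift (Complex.arg x) y (by rw [ha]; exact h1)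
  obtain ⟨c, hc, hc1, hc2⟩ := exp_lift (Complex.arg x) z (by rw [ha]; exact h3)
  rcases lt_trichotomy b c with h | h | h
  · exact Or.inl ⟨_, b, c, ha, hb, hc, hb1, h, hc2⟩
  · subst h; exact absurd (hb.symm.trans hc) h2
  · exact Or.inr ⟨_, c, b, ha, hc, hb, hc1, h, hb2⟩

/-- orientation determinant on the circle -/
def D (x y z : Circle) : ℝ :=
  ((y : ℂ).im * (x : ℂ).re - (y : ℂ).re * (x : ℂ).im) +
  ((z : ℂ).im * (y : ℂ).re - (z : ℂ).re * (y : ℂ).im) +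
  ((x : ℂ).im * (z : ℂ).re - (x : ℂ).re * (z : ℂ).im)

theorem D_cont : Continuous (fun t : Circle × Circle × Circle => D t.1 t.2.1 t.2.2) := by
  unfold D
  have : ∀ g : Circle × Circle × Circle → Circle, Continuous g →
      Continuous (fun t => ((g t : Circle) : ℂ).re) ∧
      Continuous (fun t => ((g t : Circle) : ℂ).im) := fun g hg =>
    ⟨Complex.continuous_re.comp (continuous_subtype_val.comp hg),
      Complex.continuous_im.comp (continuous_subtype_val.comp hg)⟩
  obtain ⟨a1, a2⟩ := this (fun t => t.1) (by fun_prop)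
  obtain ⟨b1, b2⟩ := this (fun t => t.2.1) (by fun_prop)
  obtain ⟨c1, c2⟩ := this (fun t => t.2.2) (by fun_prop)
  fun_prop

theorem D_swap (x y z : Circle) : D x z y = - D x y z := by unfold D; ring

theorem D_pos {x y z : Circle} (h : PosOriented x y z) : 0 < D x y z := by
  obtain ⟨a, b, c, rfl, rfl, rfl, h1, h2, h3⟩ := h
  have hD : D (Circle.exp a) (Circle.exp b) (Circle.exp c) =
      4 * Real.sin ((b - a) / 2) * Real.sin ((c - b) / 2) * Real.sin ((c - a) / 2) := by
    have e1 : ∀ t : ℝ, ((Circle.exp t : Circle) : ℂ).re = Real.cos t := by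
      intro t; rw [Circle.coe_exp, Complex.exp_ofReal_mul_I_re]
    have e2 : ∀ t : ℝ, ((Circle.exp t : Circle) : ℂ).im = Real.sin t := by
      intro t; rw [Circle.coe_exp, Complex.exp_ofReal_mul_I_im]
    unfold D
    simp only [e1, e2]
    obtain ⟨u, hu⟩ : ∃ u, u = (b - a) / 2 := ⟨_, rfl⟩
    obtain ⟨v, hv⟩ : ∃ v, v = (c - b) / 2 := ⟨_, rfl⟩
    have e3 : (c - a) / 2 = u + v := by rw [hu, hv]; ring
    have f1 : Real.sin b * Real.cos a - Real.cos b * Real.sin a = Real.sin (2 * u) := by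
      rw [← Real.sin_sub]; congr 1; rw [hu]; ring
    have f2 : Real.sin c * Real.cos b - Real.cos c * Real.sin b = Real.sin (2 * v) := by
      rw [← Real.sin_sub]; congr 1; rw [hv]; ring
    have f3 : Real.sin a * Real.cos c - Real.cos a * Real.sin c = - Real.sin (2 * (u + v)) := by
      rw [← Real.sin_sub, ← Real.sin_neg]; congr 1; rw [hu, hv]; ring
    rw [f1, f2, f3, e3, ← hu, ← hv, Real.sin_two_mul, Real.sin_two_mul, Real.sin_two_mul,
      Real.sin_add, Real.cos_add]
    have p := Real.sin_sq_add_cos_sq u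
    have q := Real.sin_sq_add_cos_sq v
    have p' : Real.cos u ^ 2 = 1 - Real.sin u ^ 2 := by linarith
    have q' : Real.cos v ^ 2 = 1 - Real.sin v ^ 2 := by linarith
    ring_nf
    rw [p', q']
    ring
  rw [hD]
  have := Real.sin_pos_of_pos_of_lt_pi (x := (b - a) / 2) (by linarith) (by linarith)
  have := Real.sin_pos_of_pos_of_lt_pi (x := (c - b) / 2) (by linarith) (by linarith)
  have := Real.sin_pos_of_pos_of_lt_pi (x := (c - a) / 2) (by linarith) (by linarith)
  positivity

theorem pos_ne {x y z : Circle} (h : PosOriented x y z) : x ≠ y ∧ y ≠ z ∧ x ≠ z := by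
  have := D_pos h
  refine ⟨?_, ?_, ?_⟩ <;> rintro rfl <;> unfold D at this <;> ring_nf at this <;> simp at this

theorem pos_of_D {x y z : Circle} (h1 : x ≠ y) (h2 : y ≠ z) (h3 : x ≠ z) (h : 0 ≤ D x y z) :
    PosOriented x y z := by
  rcases pos_tri h1 h2 h3 with h' | h'
  · exact h'
  · have := D_pos h'
    rw [D_swap] at this
    linarith

theorem exp_eq_of_near {s t : ℝ} (h : Circle.exp s = Circle.exp t) (h1 : |s - t| < 2 * Real.pi) :
    s = t := by
  obtain ⟨m, hm⟩ := Circle.exp_eq_exp.1 h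
  have hp := Real.two_pi_pos
  have : s - t = m * (2 * Real.pi) := by linarith
  rw [this, abs_mul, abs_of_pos hp] at h1
  have h2 : |(m : ℝ)| < 1 := by
    by_contra h3
    push Not at h3
    nlinarith
  have h3 : |m| < 1 := by exact_mod_cast h2
  have : m = 0 := Int.abs_lt_one_iff.1 h3
  rw [hm, this]; simp

theorem same_arc {x y y' z : Circle} (h : PosOriented x y z) (h' : PosOriented x y' z)
    (g : Circle → ℝ) (hg : Continuous g) (h0 : ∀ w, w ≠ x → w ≠ z → g w ≠ 0) :
    0 < g y * g y' := by
  obtain ⟨a, b, c, rfl, rfl, rfl, h1, h2, h3⟩ := h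
  obtain ⟨a', b', c', ha, rfl, hc, h1', h2', h3'⟩ := h'
  obtain ⟨m, hm⟩ := Circle.exp_eq_exp.1 ha
  have hs : ∀ t : ℝ, Circle.exp (t - m * (2 * Real.pi)) = Circle.exp t := by
    intro t
    rw [Circle.exp_sub, Circle.exp_int_mul_two_pi, div_one]
  have hcc : c' - m * (2 * Real.pi) = c := by
    apply exp_eq_of_near
    · rw [hs, hc]
    · rw [abs_lt]; constructor <;> linarith
  obtain ⟨b'', hb''⟩ : ∃ b'', b'' = b' - m * (2 * Real.pi) := ⟨_, rfl⟩
  rw [← hs b', ← hb'']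
  have k1 : a < b'' := by linarith
  have k2 : b'' < c := by linarith
  have hne : ∀ t, a < t → t < c → g (Circle.exp t) ≠ 0 := by
    intro t t1 t2
    apply h0
    · intro he
      have := exp_eq_of_near he (by rw [abs_lt]; constructor <;> linarith)
      linarith
    · intro he
      have := exp_eq_of_near he (by rw [abs_lt]; constructor <;> linarith)
      linarith
  by_contra hneg
  push Not at hneg
  have hcont : ContinuousOn (fun t => g (Circle.exp t)) (Set.uIcc b b'') :=
    (hg.comp Circle.exp.continuous).continuousOn
  have hiv := intermediate_value_uIcc hcont
  have h0m : (0 : ℝ) ∈ Set.uIcc (g (Circle.exp b)) (g (Circle.exp b'')) := by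
    rw [Set.mem_uIcc]
    rcases mul_nonpos_iff.1 hneg with h | h
    · right; exact ⟨h.2, h.1⟩
    · left; exact h
  obtain ⟨t, ht, ht0⟩ := hiv h0m
  rw [Set.mem_uIcc] at ht
  refine hne t ?_ ?_ ht0
  · rcases ht with h | h <;> linarith
  · rcases ht with h | h <;> linarith

theorem arc_zero {x z : Circle} (h : x ≠ z) (g : Circle → ℝ) (hg : Continuous g)
    (h0 : g x * g z < 0) : ∃ y, PosOriented x y z ∧ g y = 0 := by
  have ha := Circle.exp_arg x
  obtain ⟨c, hc, hc1, hc2⟩ := exp_lift (Complex.arg x) z (by rw [ha]; exact h)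
  set a := Complex.arg x
  have hcont : ContinuousOn (fun t => g (Circle.exp t)) (Set.uIcc a c) :=
    (hg.comp Circle.exp.continuous).continuousOn
  have hiv := intermediate_value_uIcc hcont
  have h0m : (0 : ℝ) ∈ Set.uIcc (g (Circle.exp a)) (g (Circle.exp c)) := by
    rw [Set.mem_uIcc, ha, hc]
    rcases mul_neg_iff.1 h0 with h | h
    · right; exact ⟨h.2.le, h.1.le⟩
    · left; exact ⟨h.1.le, h.2.le⟩
  obtain ⟨t, ht, ht0⟩ := hiv h0m
  rw [Set.uIcc_of_le hc1.le] at ht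
  have ta : t ≠ a := by
    rintro rfl
    simp only [ha] at ht0
    rw [ht0] at h0; simp at h0
  have tc : t ≠ c := by
    rintro rfl
    simp only [hc] at ht0
    rw [ht0] at h0; simp at h0
  exact ⟨Circle.exp t, ⟨a, t, c, ha, rfl, hc, lt_of_le_of_ne ht.1 (Ne.symm ta),
    lt_of_le_of_ne ht.2 tc, hc2⟩, ht0⟩

end Part1
section Part2

open scoped Matrix

theorem mk_openQuot {W : Type*} [AddCommGroup W] [Module ℝ W] [TopologicalSpace W]
    [ContinuousConstSMul ℝ W] :
    IsOpenQuotientMap (fun v : {v : W // v ≠ 0} => Projectivization.mk ℝ v.1 v.2) := by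
  have hmk : (fun v : {v : W // v ≠ 0} => Projectivization.mk ℝ v.1 v.2) =
      Quotient.mk (projectivizationSetoid ℝ W) := rfl
  refine ⟨?_, ?_, ?_⟩
  · rw [hmk]; exact Quotient.mk_surjective
  · rw [hmk]; exact continuous_quot_mk
  · intro S hS
    have hq : IsQuotientMap (Quotient.mk (projectivizationSetoid ℝ W)) := isQuotientMap_quot_mk
    rw [hmk]
    have : IsOpen (Quotient.mk (projectivizationSetoid ℝ W) ⁻¹'
        (Quotient.mk (projectivizationSetoid ℝ W) '' S)) := by
      have heq : Quotient.mk (projectivizationSetoid ℝ W) ⁻¹'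
        (Quotient.mk (projectivizationSetoid ℝ W) '' S) =
          ⋃ a : ℝˣ, (fun v : {v : W // v ≠ 0} => (⟨a.1 • v.1, by
            simp [v.2]⟩ : {v : W // v ≠ 0})) ⁻¹' S := by
        ext ⟨v, hv⟩
        simp only [Set.mem_preimage, Set.mem_image, Set.mem_iUnion]
        constructor
        · rintro ⟨⟨w, hw⟩, hwS, h⟩
          have h' : Projectivization.mk ℝ w hw = Projectivization.mk ℝ v hv := h
          obtain ⟨a, ha⟩ := (Projectivization.mk_eq_mk_iff ℝ w v hw hv).1 h'
          refine ⟨a, ?_⟩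
          have : (⟨a.1 • v, by simp [hv]⟩ : {v : W // v ≠ 0}) = ⟨w, hw⟩ := Subtype.ext ha
          rw [this]; exact hwS
        · rintro ⟨a, ha⟩
          refine ⟨_, ha, ?_⟩
          change Projectivization.mk ℝ _ _ = Projectivization.mk ℝ _ _
          rw [Projectivization.mk_eq_mk_iff]
          exact ⟨a, rfl⟩
      rw [heq]
      refine isOpen_iUnion fun a => hS.preimage ?_
      exact ((continuous_const_smul a.1).comp continuous_subtype_val).subtype_mk _
    exact hq.isOpen_preimage.1 this

theorem mk_cont {W : Type*} [AddCommGroup W] [Module ℝ W] [TopologicalSpace W]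
    [ContinuousConstSMul ℝ W] {X : Type*} [TopologicalSpace X] {g : X → W}
    (hg : Continuous g) (h0 : ∀ x, g x ≠ 0) :
    Continuous (fun x => Projectivization.mk ℝ (g x) (h0 x)) :=
  mk_openQuot.continuous.comp (hg.subtype_mk h0)

theorem proj_t2 {W : Type*} [AddCommGroup W] [Module ℝ W] [TopologicalSpace W]
    [ContinuousConstSMul ℝ W] (L : W →ₗ[ℝ] (Fin 3 → ℝ)) (hL : Continuous L)
    (hi : Function.Injective L) : T2Space (ℙ ℝ W) := by
  rw [t2Space_iff_of_isOpenQuotientMap (mk_openQuot (W := W))]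
  have : {q : {v : W // v ≠ 0} × {v : W // v ≠ 0} |
      Projectivization.mk ℝ q.1.1 q.1.2 = Projectivization.mk ℝ q.2.1 q.2.2} =
      {q | L q.1.1 ⨯₃ L q.2.1 = 0} := by
    ext ⟨⟨v, hv⟩, ⟨w, hw⟩⟩
    simp only [Set.mem_ofPred_eq]
    rw [Projectivization.mk_eq_mk_iff']
    constructor
    · rintro ⟨a, rfl⟩
      simp
    · intro h
      by_contra hne
      have : LinearIndependent ℝ ![L v, L w] := by
        rw [LinearIndependent.pair_iff' (by rwa [Ne, map_eq_zero_iff L hi])]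
        intro a ha
        rw [← map_smul] at ha
        have ha := hi ha
        have a0 : a ≠ 0 := by rintro rfl; simp at ha; exact hw ha.symm
        exact hne ⟨a⁻¹, by rw [← ha, smul_smul, inv_mul_cancel₀ a0, one_smul]⟩
      exact (crossProduct_ne_zero_iff_linearIndependent.2 this) h
  rw [this]
  refine isClosed_eq ?_ continuous_const
  have h1 : Continuous fun q : {v : W // v ≠ 0} × {v : W // v ≠ 0} => L q.1.1 :=
    hL.comp (continuous_subtype_val.comp continuous_fst)
  have h2 : Continuous fun q : {v : W // v ≠ 0} × {v : W // v ≠ 0} => L q.2.1 :=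
    hL.comp (continuous_subtype_val.comp continuous_snd)
  simp only [cross_apply]
  refine continuous_pi fun i => ?_
  have k1 := fun j => (continuous_apply j).comp h1
  have k2 := fun j => (continuous_apply j).comp h2
  simp only [Function.comp_def] at k1 k2
  fin_cases i <;> simp <;> exact ((k1 _).mul (k2 _)).sub ((k1 _).mul (k2 _))

instance : T2Space (ℙ ℝ (Fin 3 → ℝ)) := proj_t2 LinearMap.id continuous_id Function.injective_id

/-- functional given by dot product -/
def dl : (Fin 3 → ℝ) ≃ₗ[ℝ] Module.Dual ℝ (Fin 3 → ℝ) := (LinearEquiv.piRing ℝ ℝ (Fin 3) ℝ).symm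

theorem dl_apply (w v : Fin 3 → ℝ) : dl w v = w ⬝ᵥ v := by
  simp only [dl, LinearEquiv.piRing_symm_apply, dotProduct, smul_eq_mul]
  exact Finset.sum_congr rfl fun i _ => mul_comm _ _

theorem dl_symm_cont : Continuous (LinearEquiv.piRing ℝ ℝ (Fin 3) ℝ) := continuous_induced_dom

theorem dl_cont : Continuous dl := by
  rw [continuous_induced_rng]
  have : (⇑(LinearEquiv.piRing ℝ ℝ (Fin 3) ℝ) ∘ ⇑dl) = id := by
    funext v; exact LinearEquiv.apply_symm_apply _ v
  rw [this]; exact continuous_id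

instance : ContinuousConstSMul ℝ (Module.Dual ℝ (Fin 3 → ℝ)) := by
  constructor
  intro c
  rw [continuous_induced_rng]
  have : (⇑(LinearEquiv.piRing ℝ ℝ (Fin 3) ℝ) ∘ fun x => c • x) =
    fun x => c • (LinearEquiv.piRing ℝ ℝ (Fin 3) ℝ) x := by
    ext v; simp
  rw [this]
  exact dl_symm_cont.const_smul c

instance : T2Space (ℙ ℝ (Module.Dual ℝ (Fin 3 → ℝ))) :=
  proj_t2 (LinearEquiv.piRing ℝ ℝ (Fin 3) ℝ).toLinearMap dl_symm_cont
    (LinearEquiv.piRing ℝ ℝ (Fin 3) ℝ).injective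

/-- normalization map -/
def sig (f : (Fin 3 → ℝ) →ₗ[ℝ] ℝ) : ℙ ℝ (Fin 3 → ℝ) → (Fin 3 → ℝ) :=
  Projectivization.lift (fun v => (f v.1)⁻¹ • v.1) (by
    rintro ⟨a, ha⟩ ⟨b, hb⟩ t (h : a = t • b)
    subst h
    have : t ≠ 0 := by rintro rfl; simp at ha
    simp only [map_smul, smul_eq_mul, smul_smul]
    congr 1
    field_simp)

theorem sig_mk (f : (Fin 3 → ℝ) →ₗ[ℝ] ℝ) (v : Fin 3 → ℝ) (hv : v ≠ 0) :
    sig f (Projectivization.mk ℝ v hv) = (f v)⁻¹ • v := rfl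

theorem sig_cont (f : (Fin 3 → ℝ) →ₗ[ℝ] ℝ) (v : Fin 3 → ℝ) (hv : v ≠ 0) (hf : f v ≠ 0) :
    ContinuousAt (sig f) (Projectivization.mk ℝ v hv) := by
  have := (mk_openQuot (W := Fin 3 → ℝ)).continuousAt_comp_iff (g := sig f) (x := ⟨v, hv⟩)
  refine this.1 ?_
  have hfc : Continuous f := f.continuous_of_finiteDimensional
  change ContinuousAt (fun v : {v : Fin 3 → ℝ // v ≠ 0} => (f v.1)⁻¹ • v.1) ⟨v, hv⟩
  have h1 : ContinuousAt (fun v : {v : Fin 3 → ℝ // v ≠ 0} => f v.1) ⟨v, hv⟩ :=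
    (hfc.comp continuous_subtype_val).continuousAt
  have h2 : ContinuousAt (fun v : {v : Fin 3 → ℝ // v ≠ 0} => v.1) ⟨v, hv⟩ :=
    continuous_subtype_val.continuousAt
  exact (h1.inv₀ hf).smul h2

end Part2
section Part3

open scoped Matrix

/-- Affine data attached to the convex set. -/
structure Dat (C : Set (ℙ ℝ (Fin 3 → ℝ))) (ξ₁ : Circle → ℙ ℝ (Fin 3 → ℝ))
    (ξ₂ : Circle → Submodule ℝ (Fin 3 → ℝ)) where
  f : (Fin 3 → ℝ) →ₗ[ℝ] ℝ
  γ : Circle → (Fin 3 → ℝ)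
  n : Circle → (Fin 3 → ℝ)
  P : Set (Fin 3 → ℝ)
  γc : Continuous γ
  nc : Continuous n
  hP : IsOpen P
  nγ : ∀ y, n y ⬝ᵥ γ y = 0
  npos : ∀ x y, x ≠ y → 0 < n y ⬝ᵥ γ x
  nP : ∀ y, ∀ v ∈ P, 0 < n y ⬝ᵥ v
  det : ∀ x y z, x ≠ y → y ≠ z → x ≠ z → γ y ⬝ᵥ (γ x ⨯₃ γ z) ≠ 0
  cr : ∀ x z, x ≠ z → γ x ⨯₃ γ z ≠ 0
  seg : ∀ x z, x ≠ z → ∀ a b : ℝ, 0 < a → 0 < b → a • γ x + b • γ z ∈ P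
  exit : ∀ v ∈ P, ∀ w, w ≠ 0 → f w = 0 → ∃ t : ℝ, 0 < t ∧ ∃ s : ℝ, 0 < s ∧
    ∃ x, v + t • w = s • γ x
  fP : ∀ v ∈ P, 0 < f v
  fγ : ∀ x, f (γ x) = 1
  γ0 : ∀ x, γ x ≠ 0
  hξ₁ : ∀ x, ξ₁ x = Projectivization.mk ℝ (γ x) (γ0 x)
  hξ₂ : ∀ y v, v ∈ ξ₂ y ↔ n y ⬝ᵥ v = 0
  memC : ∀ q ∈ C, ∃ v ∈ P, ∃ hv : v ≠ 0, q = Projectivization.mk ℝ v hv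
  Pmem : ∀ v ∈ P, ∀ hv : v ≠ 0, Projectivization.mk ℝ v hv ∈ C
  clos : ∀ v, ∀ hv : v ≠ 0, Projectivization.mk ℝ v hv ∈ closure C →
    v ∈ P ∨ -v ∈ P ∨ ∃ x, ∃ s : ℝ, s ≠ 0 ∧ v = s • γ x
  γcl : ∀ x, Projectivization.mk ℝ (γ x) (γ0 x) ∈ closure C

theorem finrank_ker_dl {w : Fin 3 → ℝ} (hw : w ≠ 0) :
    finrank ℝ (LinearMap.ker (dl w)) = 2 := by
  have h := LinearMap.finrank_range_add_finrank_ker (dl w)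
  have hne : dl w ≠ 0 := by simpa using hw
  have hr : LinearMap.range (dl w) = ⊤ := LinearMap.range_eq_top.2 (LinearMap.surjective hne)
  rw [hr] at h
  simp at h
  omega

theorem mem_ker_dl {w v : Fin 3 → ℝ} : v ∈ LinearMap.ker (dl w) ↔ w ⬝ᵥ v = 0 := by
  rw [LinearMap.mem_ker, dl_apply]

theorem mk_sub_le {v : Fin 3 → ℝ} (hv : v ≠ 0) (W : Submodule ℝ (Fin 3 → ℝ)) :
    (Projectivization.mk ℝ v hv).submodule ≤ W ↔ v ∈ W := by
  rw [Projectivization.submodule_mk, Submodule.span_singleton_le_iff_mem]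

theorem mk_neg {v : Fin 3 → ℝ} (hv : v ≠ 0) (hv' : -v ≠ 0) :
    Projectivization.mk ℝ (-v) hv' = Projectivization.mk ℝ v hv := by
  rw [Projectivization.mk_eq_mk_iff']; exact ⟨-1, by simp⟩

theorem mk_smul {v : Fin 3 → ℝ} (hv : v ≠ 0) {t : ℝ} (hv' : t • v ≠ 0) :
    Projectivization.mk ℝ (t • v) hv' = Projectivization.mk ℝ v hv := by
  rw [Projectivization.mk_eq_mk_iff']; exact ⟨t, rfl⟩

theorem exists_dat
    (C : Set (ℙ ℝ (Fin 3 → ℝ))) (hCopen : IsOpen C) (hCpc : ProperlyConvex C)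
    (hstrict : StrictlyConvexBoundary C)
    (hC1 : ∀ p ∈ frontier C, ∃! W : Submodule ℝ (Fin 3 → ℝ), IsSupportingLineAt C W p)
    (ξ₁ : Circle → ℙ ℝ (Fin 3 → ℝ))
    (hξ₁ : ∃ e : Circle ≃ₜ frontier C, ∀ x, (e x : ℙ ℝ (Fin 3 → ℝ)) = ξ₁ x)
    (ξ₂ : Circle → Submodule ℝ (Fin 3 → ℝ))
    (hξ₂ : ∀ x, IsSupportingLineAt C (ξ₂ x) (ξ₁ x)) : Nonempty (Dat C ξ₁ ξ₂) := by
  obtain ⟨f, hf, hconv⟩ := hCpc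
  obtain ⟨e, he⟩ := hξ₁
  have hfc : Continuous f := f.continuous_of_finiteDimensional
  have hfr : frontier C = closure C \ C := hCopen.frontier_eq
  have ξc : Continuous ξ₁ := by
    have : ξ₁ = fun x => (e x : ℙ ℝ (Fin 3 → ℝ)) := by ext x; exact (he x).symm
    rw [this]; exact continuous_subtype_val.comp e.continuous
  have ξinj : Function.Injective ξ₁ := by
    intro x y h
    rw [← he, ← he] at h
    exact e.injective (Subtype.ext h)
  have ξfr : ∀ x, ξ₁ x ∈ frontier C := fun x => by rw [← he]; exact (e x).2
  have ξsurj : ∀ q ∈ frontier C, ∃ x, ξ₁ x = q := fun q hq =>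
    ⟨e.symm ⟨q, hq⟩, by rw [← he]; simp⟩
  -- γ
  obtain ⟨γ, hγ⟩ : ∃ γ : Circle → Fin 3 → ℝ, γ = fun x => sig f (ξ₁ x) := ⟨_, rfl⟩
  have rep : ∀ q ∈ closure C, ∃ v, ∃ hv : v ≠ 0, q = Projectivization.mk ℝ v hv ∧ f v ≠ 0 := by
    intro q hq
    induction q using Projectivization.ind with
    | h v hv => exact ⟨v, hv, rfl, hf v hv hq⟩
  have ξcl : ∀ x, ξ₁ x ∈ closure C := fun x => frontier_subset_closure (ξfr x)
  have γc : Continuous γ := by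
    rw [continuous_iff_continuousAt]
    intro x
    obtain ⟨v, hv, h1, h2⟩ := rep _ (ξcl x)
    rw [hγ]
    refine ContinuousAt.comp (g := sig f) ?_ ξc.continuousAt
    rw [h1]
    exact sig_cont f v hv h2
  have fγ : ∀ x, f (γ x) = 1 := by
    intro x
    obtain ⟨v, hv, h1, h2⟩ := rep _ (ξcl x)
    simp only [hγ, h1, sig_mk, map_smul, smul_eq_mul]
    exact inv_mul_cancel₀ h2
  have γ0 : ∀ x, γ x ≠ 0 := fun x h => by
    have := fγ x; rw [h] at this; simp at this
  have hξγ : ∀ x, ξ₁ x = Projectivization.mk ℝ (γ x) (γ0 x) := by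
    intro x
    obtain ⟨v, hv, h1, h2⟩ := rep _ (ξcl x)
    rw [h1]
    symm
    rw [Projectivization.mk_eq_mk_iff']
    exact ⟨(f v)⁻¹, by simp only [hγ, h1, sig_mk]⟩
  have γinj : Function.Injective γ := by
    intro x y h
    apply ξinj
    rw [hξγ, hξγ]
    congr 1
  have uγ : ∀ u, ∀ hu : u ≠ 0, f u ≠ 0 → ∀ x, Projectivization.mk ℝ u hu = ξ₁ x →
      u = f u • γ x := by
    intro u hu hfu x h
    simp only [hγ, ← h, sig_mk, smul_smul, mul_inv_cancel₀ hfu, one_smul]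
  -- P
  obtain ⟨P, hPd⟩ : ∃ P : Set (Fin 3 → ℝ),
      P = {v | 0 < f v ∧ ∃ hv : v ≠ 0, Projectivization.mk ℝ v hv ∈ C} := ⟨_, rfl⟩
  have fP : ∀ v ∈ P, 0 < f v := by rw [hPd]; exact fun v hv => hv.1
  have Pmem : ∀ v ∈ P, ∀ hv : v ≠ 0, Projectivization.mk ℝ v hv ∈ C := by
    rw [hPd]; exact fun v hv _ => hv.2.2
  have f0 : ∀ v, 0 < f v → v ≠ 0 := by rintro v hv rfl; simp at hv
  have memP : ∀ v, 0 < f v → ∀ hv : v ≠ 0, Projectivization.mk ℝ v hv ∈ C → v ∈ P := by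
    rw [hPd]; exact fun v h hv hC => ⟨h, hv, hC⟩
  have hP : IsOpen P := by
    have h1 : IsOpen {v : Fin 3 → ℝ | 0 < f v} := isOpen_lt continuous_const hfc
    have h2 : IsOpen (Subtype.val '' ((fun v : {v : Fin 3 → ℝ // v ≠ 0} =>
        Projectivization.mk ℝ v.1 v.2) ⁻¹' C)) :=
      (isOpen_ne.isOpenMap_subtype_val) _ (hCopen.preimage mk_openQuot.continuous)
    have : P = {v : Fin 3 → ℝ | 0 < f v} ∩ (Subtype.val '' ((fun v : {v : Fin 3 → ℝ // v ≠ 0} =>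
        Projectivization.mk ℝ v.1 v.2) ⁻¹' C)) := by
      rw [hPd]
      ext v
      constructor
      · rintro ⟨h, hv, hC⟩
        exact ⟨h, ⟨v, hv⟩, hC, rfl⟩
      · rintro ⟨h, ⟨w, hw⟩, hC, rfl⟩
        exact ⟨h, hw, hC⟩
    rw [this]; exact h1.inter h2
  have Psmul : ∀ v ∈ P, ∀ t : ℝ, 0 < t → t • v ∈ P := by
    intro v hv t ht
    have h1 : 0 < f (t • v) := by
      rw [map_smul, smul_eq_mul]; exact mul_pos ht (fP v hv)
    refine memP _ h1 (f0 _ h1) ?_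
    rw [mk_smul (f0 _ (fP v hv))]
    exact Pmem v hv _
  have Padd : ∀ v ∈ P, ∀ w ∈ P, v + w ∈ P := by
    intro v hv w hw
    have hv1 := fP v hv
    have hw1 := fP w hw
    have nrm : ∀ u ∈ P, (f u)⁻¹ • u ∈
        {w : Fin 3 → ℝ | f w = 1 ∧ ∃ hw : w ≠ 0, Projectivization.mk ℝ w hw ∈ C} := by
      intro u hu
      have hu1 := fP u hu
      have hu2 := Psmul u hu (f u)⁻¹ (inv_pos.2 hu1)
      refine ⟨?_, f0 _ (fP _ hu2), Pmem _ hu2 _⟩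
      rw [map_smul, smul_eq_mul, inv_mul_cancel₀ hu1.ne']
    have hs : 0 < f v + f w := add_pos hv1 hw1
    have := hconv (nrm v hv) (nrm w hw) (a := f v / (f v + f w)) (b := f w / (f v + f w))
      (by positivity) (by positivity) (by field_simp)
    have h2 : (f v / (f v + f w)) • (f v)⁻¹ • v + (f w / (f v + f w)) • (f w)⁻¹ • w =
        (f v + f w)⁻¹ • (v + w) := by
      rw [smul_smul, smul_smul, smul_add]
      congr 2 <;> field_simp
    rw [h2] at this
    obtain ⟨_, h3, h4⟩ := this
    have h5 : 0 < f (v + w) := by rw [map_add]; exact hs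
    refine memP _ h5 (f0 _ h5) ?_
    rw [mk_smul (f0 _ h5)] at h4
    exact h4
  have memC : ∀ q ∈ C, ∃ v ∈ P, ∃ hv : v ≠ 0, q = Projectivization.mk ℝ v hv := by
    intro q hq
    obtain ⟨v, hv, h1, h2⟩ := rep q (subset_closure hq)
    rcases lt_or_gt_of_ne h2 with h | h
    · have h3 : 0 < f (-v) := by rw [map_neg]; linarith
      have h4 := f0 _ h3
      have h5 : q = Projectivization.mk ℝ (-v) h4 := by rw [mk_neg hv h4]; exact h1
      exact ⟨-v, memP _ h3 h4 (h5 ▸ hq), h4, h5⟩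
    · exact ⟨v, memP _ h hv (h1 ▸ hq), hv, h1⟩
  -- closure
  have clP : ∀ v, 0 < f v → ∀ hv : v ≠ 0, Projectivization.mk ℝ v hv ∈ closure C →
      v ∈ closure P := by
    intro v h hv hcl
    have h1 : ContinuousAt (fun q => f v • sig f q) (Projectivization.mk ℝ v hv) :=
      ContinuousAt.const_smul (g := sig f) (sig_cont f v hv h.ne') (f v)
    have h2 := h1.continuousWithinAt.mem_closure (s := C) (t := P) hcl (by
      intro q hq
      obtain ⟨w, hw, hw0, rfl⟩ := memC q hq
      change f v • sig f (Projectivization.mk ℝ w hw0) ∈ P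
      rw [sig_mk]
      exact Psmul _ (Psmul _ hw _ (inv_pos.2 (fP w hw))) _ h)
    have h3 : f v • sig f (Projectivization.mk ℝ v hv) = v := by
      rw [sig_mk, smul_smul, mul_inv_cancel₀ h.ne', one_smul]
    simpa only [h3] using h2
  have Pcl : ∀ v ∈ closure P, ∀ hv : v ≠ 0, Projectivization.mk ℝ v hv ∈ closure C := by
    intro v hv h0
    have h1 : (⟨v, h0⟩ : {v : Fin 3 → ℝ // v ≠ 0}) ∈ closure (Subtype.val ⁻¹' P) := by
      rw [← (isOpen_ne.isOpenMap_subtype_val).preimage_closure_eq_closure_preimage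
        continuous_subtype_val]
      exact hv
    exact map_mem_closure (mk_openQuot (W := Fin 3 → ℝ)).continuous h1
      (fun w hw => Pmem _ hw _)
  have γclP : ∀ x, γ x ∈ closure P := fun x =>
    clP _ (by rw [fγ]; exact one_pos) (γ0 x) (by rw [← hξγ]; exact ξcl x)
  have cr : ∀ x z, x ≠ z → γ x ⨯₃ γ z ≠ 0 := by
    intro x z hxz
    rw [crossProduct_ne_zero_iff_linearIndependent, LinearIndependent.pair_iff' (γ0 x)]
    intro a ha
    have := congrArg f ha
    rw [map_smul, fγ, fγ, smul_eq_mul, mul_one] at this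
    rw [this, one_smul] at ha
    exact hxz (γinj ha)
  have col : ∀ w, w ≠ 0 → ∀ p q r : Fin 3 → ℝ, ∀ hp : p ≠ 0, ∀ hq : q ≠ 0, ∀ hr : r ≠ 0,
      Projectivization.mk ℝ p hp ∈ frontier C → Projectivization.mk ℝ q hq ∈ frontier C →
      Projectivization.mk ℝ r hr ∈ frontier C →
      Projectivization.mk ℝ p hp ≠ Projectivization.mk ℝ q hq →
      Projectivization.mk ℝ p hp ≠ Projectivization.mk ℝ r hr →
      Projectivization.mk ℝ q hq ≠ Projectivization.mk ℝ r hr →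
      w ⬝ᵥ p = 0 → w ⬝ᵥ q = 0 → w ⬝ᵥ r = 0 → False := by
    intro w hw p q r hp hq hr h1 h2 h3 h4 h5 h6 h7 h8 h9
    refine hstrict _ _ _ h1 h2 h3 h4 h5 h6 (LinearMap.ker (dl w)) (finrank_ker_dl hw) ?_
    rw [mk_sub_le, mk_sub_le, mk_sub_le, mem_ker_dl, mem_ker_dl, mem_ker_dl]
    exact ⟨h7, h8, h9⟩
  have γfr : ∀ x, Projectivization.mk ℝ (γ x) (γ0 x) ∈ frontier C := fun x => by
    rw [← hξγ]; exact ξfr x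
  have γne : ∀ x z, x ≠ z →
      Projectivization.mk ℝ (γ x) (γ0 x) ≠ Projectivization.mk ℝ (γ z) (γ0 z) := by
    intro x z h h'
    rw [← hξγ, ← hξγ] at h'
    exact h (ξinj h')
  have det : ∀ x y z, x ≠ y → y ≠ z → x ≠ z → γ y ⬝ᵥ (γ x ⨯₃ γ z) ≠ 0 := by
    intro x y z h1 h2 h3 h0
    refine col _ (cr x z h3) _ _ _ (γ0 x) (γ0 y) (γ0 z) (γfr x) (γfr y) (γfr z) (γne _ _ h1)
      (γne _ _ h3) (γne _ _ h2) ?_ ?_ ?_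
    · rw [dotProduct_comm]; exact dot_self_cross _ _
    · rw [dotProduct_comm]; exact h0
    · rw [dotProduct_comm]; exact dot_cross_self _ _
  have seg : ∀ x z, x ≠ z → ∀ a b : ℝ, 0 < a → 0 < b → a • γ x + b • γ z ∈ P := by
    intro x z hxz a b ha hb
    have hfu : f (a • γ x + b • γ z) = a + b := by
      rw [map_add, map_smul, map_smul, fγ, fγ]; simp
    have hfu' : 0 < f (a • γ x + b • γ z) := by rw [hfu]; positivity
    have hu0 := f0 _ hfu'
    by_contra hnP
    have hcl : a • γ x + b • γ z ∈ closure P := by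
      have s1 : ∀ t : ℝ, 0 < t → ∀ v ∈ closure P, t • v ∈ closure P := fun t ht v hv =>
        map_mem_closure (continuous_const_smul t) hv (fun w hw => Psmul w hw t ht)
      exact map_mem_closure₂ continuous_add (s1 a ha _ (γclP x)) (s1 b hb _ (γclP z))
        (fun v hv w hw => Padd v hv w hw)
    have hufr : Projectivization.mk ℝ _ hu0 ∈ frontier C := by
      rw [hfr]
      exact ⟨Pcl _ hcl hu0, fun h => hnP (memP _ hfu' hu0 h)⟩
    refine col _ (cr x z hxz) _ _ _ (γ0 x) (γ0 z) hu0 (γfr x) (γfr z) hufr (γne _ _ hxz)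
      ?_ ?_ ?_ ?_ ?_
    · intro h
      have h1 := uγ _ hu0 hfu'.ne' x (h.symm.trans (hξγ x).symm)
      rw [hfu] at h1
      have h2 : b • γ z = b • γ x := by
        have : b • γ z = (a • γ x + b • γ z) - a • γ x := by abel
        rw [this, h1, add_smul]; abel
      exact hxz (γinj (smul_right_injective _ hb.ne' h2)).symm
    · intro h
      have h1 := uγ _ hu0 hfu'.ne' z (h.symm.trans (hξγ z).symm)
      rw [hfu] at h1
      have h2 : a • γ x = a • γ z := by
        have : a • γ x = (a • γ x + b • γ z) - b • γ z := by abel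
        rw [this, h1, add_smul]; abel
      exact hxz (γinj (smul_right_injective _ ha.ne' h2))
    · rw [dotProduct_comm]; exact dot_self_cross _ _
    · rw [dotProduct_comm]; exact dot_cross_self _ _
    · rw [dotProduct_add, dotProduct_smul, dotProduct_smul, dotProduct_comm, dot_self_cross,
        dotProduct_comm, dot_cross_self]; simp
  -- normals
  obtain ⟨c0, hc0⟩ : ∃ c0, c0 ∈ P := by
    have h1 : (closure P).Nonempty := ⟨_, γclP 1⟩
    exact closure_nonempty_iff.1 h1
  have hn : ∀ y, ∃ m : Fin 3 → ℝ, (∀ v, v ∈ ξ₂ y ↔ m ⬝ᵥ v = 0) ∧ m ⬝ᵥ c0 = 1 := by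
    intro y
    obtain ⟨hr, -, -, hd⟩ := hξ₂ y
    have hlt : ξ₂ y < ⊤ := by
      rw [lt_top_iff_ne_top]
      intro h
      rw [h] at hr
      simp at hr
    obtain ⟨φ, hφ0, hφ⟩ := Submodule.exists_le_ker_of_lt_top (ξ₂ y) hlt
    obtain ⟨w, rfl⟩ := dl.surjective φ
    have hw : w ≠ 0 := by rintro rfl; simp at hφ0
    have heq : ξ₂ y = LinearMap.ker (dl w) :=
      Submodule.eq_of_le_of_finrank_eq hφ (by rw [hr, finrank_ker_dl hw])
    have hwc : w ⬝ᵥ c0 ≠ 0 := by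
      intro h
      have h1 : Projectivization.mk ℝ c0 (f0 _ (fP _ hc0)) ∈ projLine (ξ₂ y) ∩ C := by
        refine ⟨?_, Pmem _ hc0 _⟩
        change Projectivization.submodule _ ≤ _
        rw [mk_sub_le, heq, mem_ker_dl]; exact h
      rw [hd] at h1
      exact h1
    refine ⟨(w ⬝ᵥ c0)⁻¹ • w, ?_, ?_⟩
    · intro v
      rw [heq, mem_ker_dl, smul_dotProduct, smul_eq_mul, mul_eq_zero]
      simp [hwc]
    · rw [smul_dotProduct, smul_eq_mul, inv_mul_cancel₀ hwc]
  choose n hn1 hn2 using hn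
  have nγ : ∀ y, n y ⬝ᵥ γ y = 0 := by
    intro y
    have := (hξ₂ y).2.2.1
    rw [hξγ, mk_sub_le, hn1] at this
    exact this
  have nP : ∀ y, ∀ v ∈ P, 0 < n y ⬝ᵥ v := by
    intro y v hv
    have hne : ∀ v ∈ P, n y ⬝ᵥ v ≠ 0 := by
      intro v hv h
      have h1 : Projectivization.mk ℝ v (f0 _ (fP _ hv)) ∈ projLine (ξ₂ y) ∩ C := by
        refine ⟨?_, Pmem _ hv _⟩
        change Projectivization.submodule _ ≤ _
        rw [mk_sub_le, hn1]; exact h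
      rw [(hξ₂ y).2.2.2] at h1
      exact h1
    by_contra hneg
    have hlt : n y ⬝ᵥ v < 0 := lt_of_le_of_ne (not_lt.1 hneg) (hne v hv)
    apply hne _ (Padd _ hv _ (Psmul _ hc0 (-(n y ⬝ᵥ v)) (by linarith)))
    rw [dotProduct_add, dotProduct_smul, hn2]; simp
  have npos : ∀ x y, x ≠ y → 0 < n y ⬝ᵥ γ x := by
    intro x y h
    have := nP y _ (seg x y h 1 1 one_pos one_pos)
    rw [dotProduct_add, dotProduct_smul, dotProduct_smul, nγ] at this
    simpa using this
  have nuniq : ∀ y m, m ⬝ᵥ γ y = 0 → m ⬝ᵥ c0 = 1 → (∀ v ∈ P, 0 < m ⬝ᵥ v) → m = n y := by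
    intro y m h1 h2 h3
    have m0 : m ≠ 0 := by rintro rfl; simp at h2
    have hs : IsSupportingLineAt C (LinearMap.ker (dl m)) (ξ₁ y) := by
      refine ⟨finrank_ker_dl m0, ξfr y, ?_, ?_⟩
      · rw [hξγ, mk_sub_le, mem_ker_dl]; exact h1
      · rw [Set.eq_empty_iff_forall_notMem]
        rintro q ⟨hq1, hq2⟩
        obtain ⟨v, hv, hv0, rfl⟩ := memC q hq2
        have hq1 : Projectivization.submodule _ ≤ _ := hq1
        rw [mk_sub_le, mem_ker_dl] at hq1
        exact (h3 v hv).ne' hq1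
    have heq := (hC1 _ (ξfr y)).unique hs (hξ₂ y)
    have hall : ∀ v, m ⬝ᵥ v = n y ⬝ᵥ v := by
      intro v
      have h4 : v - (n y ⬝ᵥ v) • c0 ∈ ξ₂ y := by
        rw [hn1, dotProduct_sub, dotProduct_smul, hn2]; simp
      rw [← heq, mem_ker_dl, dotProduct_sub, dotProduct_smul, h2] at h4
      simp at h4
      linarith
    exact dotProduct_eq _ _ hall
  have nc : Continuous n := by
    obtain ⟨ε, hε, hball⟩ := Metric.isOpen_iff.1 hP c0 hc0
    have hbd : ∀ y i, |n y i| ≤ 2 / ε := by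
      intro y i
      have hmem : ∀ s : ℝ, |s| = ε / 2 → c0 + s • Pi.single i 1 ∈ P := by
        intro s hs
        apply hball
        rw [Metric.mem_ball, dist_eq_norm]
        simp only [add_sub_cancel_left, norm_smul, Real.norm_eq_abs, hs]
        rw [Pi.norm_single]
        simp; linarith
      have h1 := nP y _ (hmem (ε / 2) (abs_of_pos (by linarith)))
      have h2 := nP y _ (hmem (-(ε / 2)) (by rw [abs_neg]; exact abs_of_pos (by linarith)))
      rw [dotProduct_add, dotProduct_smul, hn2, dotProduct_single] at h1 h2
      simp only [smul_eq_mul, mul_one] at h1 h2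
      rw [abs_le]
      constructor
      · rw [neg_le_iff_add_nonneg, ← sub_nonneg]
        have : (n y i + 2 / ε - 0) = (2 / ε) * (1 + ε / 2 * n y i) := by field_simp; ring
        rw [this]; positivity
      · rw [← sub_nonneg]
        have : (2 / ε - n y i) = (2 / ε) * (1 + -(ε / 2) * n y i) := by field_simp; ring
        rw [this]; positivity
    have hK : IsCompact (Set.pi Set.univ (fun _ : Fin 3 => Set.Icc (-(2 / ε)) (2 / ε))) :=
      isCompact_univ_pi fun _ => isCompact_Icc
    have dc : ∀ v : Fin 3 → ℝ, Continuous (fun m : Fin 3 → ℝ => m ⬝ᵥ v) := fun v => by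
      unfold dotProduct; fun_prop
    rw [continuous_iff_ultrafilter]
    intro y g hg
    have hle : ((g.map n : Ultrafilter _) : Filter (Fin 3 → ℝ)) ≤
        𝓟 (Set.pi Set.univ (fun _ : Fin 3 => Set.Icc (-(2 / ε)) (2 / ε))) := by
      rw [le_principal_iff]
      refine Filter.mem_map.2 (Filter.univ_mem' fun y i _ => ?_)
      exact abs_le.1 (hbd y i)
    obtain ⟨m, -, hm⟩ := hK.ultrafilter_le_nhds _ hle
    have hm : Tendsto n g (𝓝 m) := hm
    have hy : Tendsto γ g (𝓝 (γ y)) := (γc.tendsto y).mono_left hg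
    have hmγ : m ⬝ᵥ γ y = 0 := by
      have h1 : Tendsto (fun t => n t ⬝ᵥ γ t) g (𝓝 (m ⬝ᵥ γ y)) := by
        have hc : Continuous (fun q : (Fin 3 → ℝ) × (Fin 3 → ℝ) => q.1 ⬝ᵥ q.2) := by
          unfold dotProduct; fun_prop
        exact (hc.tendsto (m, γ y)).comp (hm.prodMk_nhds hy)
      simp only [nγ] at h1
      exact (tendsto_nhds_unique h1 tendsto_const_nhds)
    have hm1 : m ⬝ᵥ c0 = 1 := by
      have h1 := ((dc c0).tendsto m).comp hm
      simp only [Function.comp_def, hn2] at h1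
      exact (tendsto_nhds_unique h1 tendsto_const_nhds)
    have hm2 : ∀ v ∈ P, 0 ≤ m ⬝ᵥ v := by
      intro v hv
      have h1 := ((dc v).tendsto m).comp hm
      exact ge_of_tendsto' h1 fun t => (nP t v hv).le
    have hm3 : ∀ v ∈ P, 0 < m ⬝ᵥ v := by
      intro v hv
      refine lt_of_le_of_ne (hm2 v hv) fun h => ?_
      have hc : Continuous (fun s : ℝ => v - s • c0) := by fun_prop
      have ho : IsOpen ((fun s : ℝ => v - s • c0) ⁻¹' P) := hP.preimage hc
      obtain ⟨δ, hδ, hb⟩ := Metric.isOpen_iff.1 ho 0 (by simpa using hv)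
      have h2 : δ / 2 ∈ Metric.ball (0 : ℝ) δ := by
        rw [Metric.mem_ball, dist_zero_right, Real.norm_eq_abs, abs_of_pos] <;> linarith
      have h3 := hm2 _ (hb h2)
      rw [dotProduct_sub, dotProduct_smul, hm1, ← h] at h3
      simp at h3
      linarith
    rw [← nuniq y m hmγ hm1 hm3]
    exact hm
  have exit : ∀ v ∈ P, ∀ w, w ≠ 0 → f w = 0 → ∃ t : ℝ, 0 < t ∧ ∃ s : ℝ, 0 < s ∧
    ∃ x, v + t • w = s • γ x := by
    intro v hv w hw hfw
    have hfv := fP v hv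
    have fu : ∀ s : ℝ, f ((1 - s) • v + s • w) = (1 - s) * f v := by
      intro s; rw [map_add, map_smul, map_smul, hfw]; simp
    have hu0 : ∀ s : ℝ, (1 - s) • v + s • w ≠ 0 := by
      intro s h
      have h1 := fu s
      rw [h, map_zero] at h1
      have h2 : 1 - s = 0 := by
        rcases mul_eq_zero.1 h1.symm with h | h
        · exact h
        · exact absurd h hfv.ne'
      have h3 : s = 1 := by linarith
      rw [h3] at h; simp at h; exact hw h
    let g : ℝ → ℙ ℝ (Fin 3 → ℝ) := fun s => Projectivization.mk ℝ _ (hu0 s)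
    have hg : Continuous g := mk_cont (by fun_prop) hu0
    have hpre : IsPreconnected (Set.univ : Set ℝ) := isPreconnected_univ
    have hne : (g ⁻¹' C) ≠ Set.univ := by
      intro h
      have h1 : (1 : ℝ) ∈ g ⁻¹' C := by rw [h]; trivial
      have := hf _ _ (subset_closure h1)
      rw [fu] at this; simp at this
    have hg0 : g 0 ∈ C := by
      have : g 0 = Projectivization.mk ℝ v (f0 _ hfv) := by
        change Projectivization.mk ℝ _ _ = Projectivization.mk ℝ _ _
        congr 1; simp
      rw [this]; exact Pmem v hv _
    have hg1 : g 1 ∉ closure C := by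
      intro h
      have := hf _ _ h
      rw [fu] at this; simp at this
    have himg : IsPreconnected (g '' Set.Icc 0 1) :=
      (isPreconnected_Icc).image g hg.continuousOn
    have hfne : ∃ s ∈ Set.Icc (0 : ℝ) 1, g s ∈ frontier C := by
      by_contra hno
      push Not at hno
      have hsub : g '' Set.Icc 0 1 ⊆ C ∪ (closure C)ᶜ := by
        rintro _ ⟨s, hs, rfl⟩
        have := hno s hs
        rw [hfr] at this
        by_cases h : g s ∈ C
        · exact Or.inl h
        · exact Or.inr fun h' => this ⟨h', h⟩
      obtain ⟨q, -, hq1, hq2⟩ := himg C (closure C)ᶜ hCopen isClosed_closure.isOpen_compl hsub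
        ⟨g 0, ⟨0, by simp, rfl⟩, hg0⟩ ⟨g 1, ⟨1, by simp, rfl⟩, hg1⟩
      exact hq2 (subset_closure hq1)
    obtain ⟨s, hs, hsf⟩ := hfne
    have s0 : s ≠ 0 := by
      rintro rfl
      rw [hfr] at hsf; exact hsf.2 hg0
    have s1 : s ≠ 1 := by
      rintro rfl
      rw [hfr] at hsf; exact hg1 hsf.1
    have sp : 0 < s := lt_of_le_of_ne hs.1 (Ne.symm s0)
    have sl : 0 < 1 - s := by
      have := lt_of_le_of_ne hs.2 s1; linarith
    obtain ⟨x, hx⟩ := ξsurj _ hsf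
    have h1 := uγ _ (hu0 s) (by rw [fu]; positivity) x hx.symm
    rw [fu] at h1
    refine ⟨s / (1 - s), by positivity, f v, hfv, x, ?_⟩
    apply smul_right_injective _ sl.ne'
    change (1 - s) • (v + (s / (1 - s)) • w) = (1 - s) • f v • γ x
    rw [smul_smul, ← h1, smul_add, smul_smul]
    congr 2
    field_simp
  refine ⟨⟨f, γ, n, P, γc, nc, hP, nγ, npos, nP, det, cr, seg, exit, fP, fγ, γ0, hξγ, hn1, memC,
    Pmem, ?_, fun x => frontier_subset_closure (γfr x)⟩⟩
  intro v hv hcl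
  have hfv := hf v hv hcl
  by_cases hC : Projectivization.mk ℝ v hv ∈ C
  · rcases lt_or_gt_of_ne hfv with h | h
    · right; left
      have h3 : 0 < f (-v) := by rw [map_neg]; linarith
      refine memP _ h3 (f0 _ h3) ?_
      rw [mk_neg hv]; exact hC
    · left; exact memP v h hv hC
  · right; right
    have : Projectivization.mk ℝ v hv ∈ frontier C := by rw [hfr]; exact ⟨hcl, hC⟩
    obtain ⟨x, hx⟩ := ξsurj _ this
    exact ⟨x, f v, hfv, uγ v hv hfv x hx.symm⟩

end Part3
section Part4

open scoped Matrix

theorem cross_span {u v p : Fin 3 → ℝ} (h : u ⨯₃ v ≠ 0) (hp : (u ⨯₃ v) ⬝ᵥ p = 0) :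
    ∃ a b : ℝ, p = a • u + b • v := by
  obtain ⟨N, hN⟩ : ∃ N, N = u ⨯₃ v := ⟨_, rfl⟩
  have hNN : N ⬝ᵥ N ≠ 0 := by rw [Ne, dotProduct_self_eq_zero, hN]; exact h
  have key : (N ⬝ᵥ N) • p = ((p ⨯₃ v) ⬝ᵥ N) • u + ((u ⨯₃ p) ⬝ᵥ N) • v + (N ⬝ᵥ p) • N := by
    rw [hN]
    ext i
    fin_cases i <;> simp [cross_apply, dotProduct, Fin.sum_univ_three] <;> ring
  rw [← hN] at hp
  rw [hp, zero_smul, add_zero] at key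
  refine ⟨(N ⬝ᵥ N)⁻¹ * ((p ⨯₃ v) ⬝ᵥ N), (N ⬝ᵥ N)⁻¹ * ((u ⨯₃ p) ⬝ᵥ N), ?_⟩
  rw [mul_smul, mul_smul, ← smul_add, ← key, smul_smul, inv_mul_cancel₀ hNN, one_smul]

theorem cross_perp {u v m : Fin 3 → ℝ} (h : u ⨯₃ v ≠ 0) (h1 : m ⬝ᵥ u = 0) (h2 : m ⬝ᵥ v = 0) :
    ∃ a : ℝ, m = a • (u ⨯₃ v) := by
  have hz : (u ⨯₃ v) ⨯₃ m = 0 := by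
    have key : (u ⨯₃ v) ⨯₃ m = (m ⬝ᵥ u) • v - (m ⬝ᵥ v) • u := by
      ext i
      fin_cases i <;> simp [cross_apply, Matrix.vec3_dotProduct] <;> ring
    rw [key, h1, h2]; simp
  by_contra hne
  push Not at hne
  have : LinearIndependent ℝ ![u ⨯₃ v, m] := by
    rw [LinearIndependent.pair_iff' h]
    intro a ha
    exact hne a ha.symm
  exact (crossProduct_ne_zero_iff_linearIndependent.2 this) hz

theorem dl_ne {w : Fin 3 → ℝ} (h : w ≠ 0) : dl w ≠ 0 := by simpa using h

theorem flag_iff {v w : Fin 3 → ℝ} (hv : v ≠ 0) (hw : dl w ≠ 0) :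
    (Projectivization.mk ℝ v hv).submodule ≤
      (Projectivization.mk ℝ (dl w) hw).submodule.dualCoannihilator ↔ w ⬝ᵥ v = 0 := by
  rw [mk_sub_le, Projectivization.submodule_mk, Submodule.mem_dualCoannihilator]
  constructor
  · intro h
    have := h _ (Submodule.mem_span_singleton_self _)
    rwa [dl_apply] at this
  · intro h φ hφ
    obtain ⟨a, rfl⟩ := Submodule.mem_span_singleton.1 hφ
    rw [LinearMap.smul_apply, dl_apply, h, smul_zero]

theorem mk_dl_eq {v w : Fin 3 → ℝ} (hv : dl v ≠ 0) (hw : dl w ≠ 0) :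
    Projectivization.mk ℝ (dl v) hv = Projectivization.mk ℝ (dl w) hw ↔ ∃ a : ℝ, a • w = v := by
  rw [Projectivization.mk_eq_mk_iff']
  constructor
  · rintro ⟨a, ha⟩
    rw [← map_smul] at ha
    exact ⟨a, dl.injective ha⟩
  · rintro ⟨a, ha⟩
    exact ⟨a, by rw [← map_smul, ha]⟩

theorem cross_cont : Continuous (fun q : (Fin 3 → ℝ) × (Fin 3 → ℝ) => q.1 ⨯₃ q.2) := by
  simp only [cross_apply]
  refine continuous_pi fun i => ?_
  fin_cases i <;> simp <;> fun_prop

theorem dot_cont : Continuous (fun q : (Fin 3 → ℝ) × (Fin 3 → ℝ) => q.1 ⬝ᵥ q.2) := by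
  unfold dotProduct; fun_prop

namespace Dat

variable {C : Set (ℙ ℝ (Fin 3 → ℝ))} {ξ₁ : Circle → ℙ ℝ (Fin 3 → ℝ)}
    {ξ₂ : Circle → Submodule ℝ (Fin 3 → ℝ)} (d : Dat C ξ₁ ξ₂)

/-- the intersection vector -/
def pv (t : Circle × Circle × Circle) : Fin 3 → ℝ :=
  (d.n t.2.1 ⬝ᵥ d.γ t.2.2) • d.γ t.1 + (-(d.n t.2.1 ⬝ᵥ d.γ t.1)) • d.γ t.2.2

theorem dot_comb (m : Fin 3 → ℝ) (a b : ℝ) (x z : Circle) :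
    m ⬝ᵥ (a • d.γ x + b • d.γ z) = a * (m ⬝ᵥ d.γ x) + b * (m ⬝ᵥ d.γ z) := by
  rw [dotProduct_add, dotProduct_smul, dotProduct_smul]; rfl

theorem n_pv (t : Circle × Circle × Circle) : d.n t.2.1 ⬝ᵥ d.pv t = 0 := by
  unfold pv; rw [dot_comb]; ring

theorem comb_ne {x z : Circle} (h : x ≠ z) {a b : ℝ} (hab : a ≠ 0 ∨ b ≠ 0) :
    a • d.γ x + b • d.γ z ≠ 0 := by
  intro h0
  have h1 := d.dot_comb (d.n x) a b x z
  have h2 := d.dot_comb (d.n z) a b x z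
  rw [h0, dotProduct_zero, d.nγ] at h1 h2
  have p1 := d.npos z x h.symm
  have p2 := d.npos x z h
  rcases hab with ha | hb
  · apply ha
    have : a * (d.n z ⬝ᵥ d.γ x) = 0 := by linarith
    exact (mul_eq_zero.1 this).resolve_right p2.ne'
  · apply hb
    have : b * (d.n x ⬝ᵥ d.γ z) = 0 := by linarith
    exact (mul_eq_zero.1 this).resolve_right p1.ne'

theorem pv_ne (t : Circle × Circle × Circle) (h : t.1 ≠ t.2.2) : d.pv t ≠ 0 := by
  apply d.comb_ne h
  by_cases hy : t.2.1 = t.2.2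
  · right
    rw [hy]
    exact neg_ne_zero.2 (d.npos _ _ h).ne'
  · left
    exact (d.npos _ _ (Ne.symm hy)).ne'

theorem pv_cont : Continuous d.pv := by
  unfold pv
  have g1 : Continuous (fun t : Circle × Circle × Circle => d.γ t.1) := d.γc.comp (by fun_prop)
  have g2 : Continuous (fun t : Circle × Circle × Circle => d.γ t.2.2) := d.γc.comp (by fun_prop)
  have g3 : Continuous (fun t : Circle × Circle × Circle => d.n t.2.1) := d.nc.comp (by fun_prop)
  have a1 := dot_cont.comp (g3.prodMk g2)
  have a2 := dot_cont.comp (g3.prodMk g1)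
  simp only [Function.comp_def] at a1 a2
  exact (a1.smul g1).add (a2.neg.smul g2)

theorem notcl {x z : Circle} (h : x ≠ z) {a b : ℝ} (hab : a * b < 0)
    (hv : a • d.γ x + b • d.γ z ≠ 0) :
    Projectivization.mk ℝ _ hv ∉ closure C := by
  intro hcl
  have h1 := d.dot_comb (d.n x) a b x z
  have h2 := d.dot_comb (d.n z) a b x z
  rw [d.nγ] at h1 h2
  have p1 := d.npos z x h.symm
  have p2 := d.npos x z h
  have key : (d.n x ⬝ᵥ (a • d.γ x + b • d.γ z)) * (d.n z ⬝ᵥ (a • d.γ x + b • d.γ z)) < 0 := by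
    rw [h1, h2]
    have := mul_pos p1 p2
    nlinarith
  rcases d.clos _ hv hcl with hP | hP | ⟨w, s, hs, hw⟩
  · have := mul_pos (d.nP x _ hP) (d.nP z _ hP); linarith
  · have := mul_pos (d.nP x _ hP) (d.nP z _ hP)
    rw [dotProduct_neg, dotProduct_neg] at this
    linarith
  · have nn : ∀ y, 0 ≤ d.n y ⬝ᵥ d.γ w := by
      intro y
      by_cases hyw : w = y
      · rw [hyw, d.nγ]
      · exact (d.npos w y hyw).le
    rw [hw, dotProduct_smul, dotProduct_smul, smul_eq_mul, smul_eq_mul] at key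
    have := mul_nonneg (nn x) (nn z)
    have := mul_nonneg (mul_self_nonneg s) this
    nlinarith

theorem signs {x z : Circle} (h : x ≠ z) {a b : ℝ} (hv : a • d.γ x + b • d.γ z ≠ 0)
    (hcl : Projectivization.mk ℝ _ hv ∉ closure C) : a * b < 0 := by
  by_contra hab
  push Not at hab
  apply hcl
  by_cases ha : a = 0
  · have : Projectivization.mk ℝ _ hv = Projectivization.mk ℝ (d.γ z) (d.γ0 z) := by
      rw [Projectivization.mk_eq_mk_iff']; exact ⟨b, by simp [ha]⟩
    rw [this]; exact d.γcl z
  by_cases hb : b = 0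
  · have : Projectivization.mk ℝ _ hv = Projectivization.mk ℝ (d.γ x) (d.γ0 x) := by
      rw [Projectivization.mk_eq_mk_iff']; exact ⟨a, by simp [hb]⟩
    rw [this]; exact d.γcl x
  have hab' : 0 < a * b := lt_of_le_of_ne hab (Ne.symm (mul_ne_zero ha hb))
  apply subset_closure
  rcases mul_pos_iff.1 hab' with h' | h'
  · exact d.Pmem _ (d.seg x z h a b h'.1 h'.2) hv
  · have hm := d.seg x z h (-a) (-b) (by linarith [h'.1]) (by linarith [h'.2])
    have heq : (-a) • d.γ x + (-b) • d.γ z = -(a • d.γ x + b • d.γ z) := by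
      rw [neg_smul, neg_smul, neg_add]
    rw [heq] at hm
    have := d.Pmem _ hm (neg_ne_zero.2 hv)
    rwa [mk_neg hv] at this

theorem chord {w c p : Fin 3 → ℝ} (hc : c ∈ d.P) (hwc : w ⬝ᵥ c = 0)
    (hp : p ≠ 0) (hwp : w ⬝ᵥ p = 0) (hcl : Projectivization.mk ℝ p hp ∉ closure C) :
    ∃ x z, x ≠ z ∧ w ⬝ᵥ d.γ x = 0 ∧ w ⬝ᵥ d.γ z = 0 := by
  have hfc := d.fP c hc
  have hc0 : c ≠ 0 := by rintro rfl; simp at hfc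
  obtain ⟨e, he⟩ : ∃ e, e = d.f c • p - d.f p • c := ⟨_, rfl⟩
  have e0 : e ≠ 0 := by
    intro h
    rw [he, sub_eq_zero] at h
    apply hcl
    have : Projectivization.mk ℝ p hp = Projectivization.mk ℝ c hc0 := by
      rw [Projectivization.mk_eq_mk_iff']
      exact ⟨(d.f c)⁻¹ * d.f p, by
        rw [mul_smul, ← h, smul_smul, inv_mul_cancel₀ hfc.ne', one_smul]⟩
    rw [this]
    exact subset_closure (d.Pmem c hc hc0)
  have fe : d.f e = 0 := by
    rw [he, map_sub, map_smul, map_smul, smul_eq_mul, smul_eq_mul]; ring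
  have we : w ⬝ᵥ e = 0 := by
    rw [he, dotProduct_sub, dotProduct_smul, dotProduct_smul, hwc, hwp]; simp
  obtain ⟨t, ht, s, hs, x, hx⟩ := d.exit c hc e e0 fe
  obtain ⟨t', ht', s', hs', z, hz⟩ := d.exit c hc (-e) (neg_ne_zero.2 e0) (by rw [map_neg, fe, neg_zero])
  have on : ∀ t s : ℝ, 0 < s → ∀ x, c + t • e = s • d.γ x → w ⬝ᵥ d.γ x = 0 := by
    intro t s hs x hx
    have h1 := congrArg (fun v => w ⬝ᵥ v) hx
    simp only [dotProduct_add, dotProduct_smul, hwc, we, smul_eq_mul] at h1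
    have : s * (w ⬝ᵥ d.γ x) = 0 := by linarith
    exact (mul_eq_zero.1 this).resolve_left hs.ne'
  refine ⟨x, z, ?_, on t s hs x hx, on (-t') s' hs' z (by rw [← hz]; simp)⟩
  rintro rfl
  have f1 := congrArg d.f hx
  have f2 := congrArg d.f hz
  simp only [map_add, map_smul, map_neg, fe, d.fγ, smul_eq_mul] at f1 f2
  have hss : s = s' := by linarith
  rw [← hss, ← hx] at hz
  have h3 : (t + t') • e = 0 := by
    have := add_left_cancel hz
    rw [add_smul, ← this]; simp
  rcases smul_eq_zero.1 h3 with h | h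
  · linarith
  · exact e0 h

theorem uniq {x y y' z : Circle} (h : PosOriented x y z) (h' : PosOriented x y' z) {a b : ℝ}
    (hab : a * b < 0) (h1 : d.n y ⬝ᵥ (a • d.γ x + b • d.γ z) = 0)
    (h2 : d.n y' ⬝ᵥ (a • d.γ x + b • d.γ z) = 0) : y = y' := by
  by_contra hne
  obtain ⟨hxy, hyz, hxz⟩ := pos_ne h
  obtain ⟨hxy', hyz', -⟩ := pos_ne h'
  rw [dot_comb] at h1 h2
  have hA := d.npos x y hxy
  have hB := d.npos z y hyz.symm
  have hA' := d.npos x y' hxy'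
  have hB' := d.npos z y' hyz'.symm
  set A := d.n y ⬝ᵥ d.γ x
  set B := d.n y ⬝ᵥ d.γ z
  set A' := d.n y' ⬝ᵥ d.γ x
  set B' := d.n y' ⬝ᵥ d.γ z
  have ha : a ≠ 0 := by rintro rfl; simp at hab
  have hAB : B' * A = B * A' := by
    apply mul_left_cancel₀ ha
    linear_combination B' * h1 - B * h2
  obtain ⟨m, hm⟩ : ∃ m, m = B' • d.n y - B • d.n y' := ⟨_, rfl⟩
  have md : ∀ v, m ⬝ᵥ v = B' * (d.n y ⬝ᵥ v) - B * (d.n y' ⬝ᵥ v) := by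
    intro v; rw [hm, sub_dotProduct, smul_dotProduct, smul_dotProduct]; rfl
  obtain ⟨μ, hμ⟩ := cross_perp (d.cr x z hxz) (m := m)
    (by rw [md]; change B' * A - B * A' = 0; linarith)
    (by rw [md]; change B' * B - B * B' = 0; ring)
  have k1 : m ⬝ᵥ d.γ y < 0 := by
    rw [md, d.nγ]
    have := mul_pos hB (d.npos y y' hne)
    linarith
  have k2 : 0 < m ⬝ᵥ d.γ y' := by
    rw [md, d.nγ]
    have := mul_pos hB' (d.npos y' y (Ne.symm hne))
    linarith
  have gc : Continuous (fun w => d.γ w ⬝ᵥ (d.γ x ⨯₃ d.γ z)) :=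
    dot_cont.comp (d.γc.prodMk continuous_const)
  have := same_arc h h' (fun w => d.γ w ⬝ᵥ (d.γ x ⨯₃ d.γ z)) gc
    (fun w hw1 hw2 => d.det x w z hw1.symm hw2 hxz)
  rw [hμ, smul_dotProduct, dotProduct_comm, smul_eq_mul] at k1 k2
  have k3 := mul_neg_of_neg_of_pos k1 k2
  have := mul_nonneg (mul_self_nonneg μ) this.le
  nlinarith

/-- The space of positive triples. -/
abbrev T := {t : Circle × Circle × Circle // PosOriented t.1 t.2.1 t.2.2}

theorem ne13 (t : T) : t.1.1 ≠ t.1.2.2 := (pos_ne t.2).2.2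

theorem pv_sign (t : T) :
    (d.n t.1.2.1 ⬝ᵥ d.γ t.1.2.2) * (-(d.n t.1.2.1 ⬝ᵥ d.γ t.1.1)) < 0 := by
  obtain ⟨h1, h2, h3⟩ := pos_ne t.2
  have := mul_pos (d.npos _ _ h1) (d.npos _ _ h2.symm)
  nlinarith

theorem dot_cross1 (u v : Fin 3 → ℝ) : (u ⨯₃ v) ⬝ᵥ u = 0 := by
  rw [dotProduct_comm]; exact dot_self_cross _ _

theorem dot_cross2 (u v : Fin 3 → ℝ) : (u ⨯₃ v) ⬝ᵥ v = 0 := by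
  rw [dotProduct_comm]; exact dot_cross_self _ _

/-- The map. -/
def Φ (t : T) : ↥(Omega2 C) :=
  ⟨(Projectivization.mk ℝ (d.pv t.1) (d.pv_ne t.1 (ne13 t)),
    Projectivization.mk ℝ (dl (d.γ t.1.1 ⨯₃ d.γ t.1.2.2)) (dl_ne (d.cr _ _ (ne13 t)))), by
    refine ⟨?_, ?_, ?_⟩
    · change Projectivization.submodule _ ≤ _
      rw [flag_iff]
      unfold pv
      rw [dot_comb, dot_cross1, dot_cross2]; simp
    · exact d.notcl (ne13 t) (d.pv_sign t) _
    · have hm := d.seg _ _ (ne13 t) 1 1 one_pos one_pos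
      refine ⟨_, d.Pmem _ hm (d.comb_ne (ne13 t) (Or.inl one_ne_zero)), ?_⟩
      rw [flag_iff, dot_comb, dot_cross1, dot_cross2]; simp⟩

theorem Φ_fst (t : T) : (d.Φ t).1.1 = Projectivization.mk ℝ (d.pv t.1) (d.pv_ne t.1 (ne13 t)) := rfl

theorem Φ_snd (t : T) : (d.Φ t).1.2 =
  Projectivization.mk ℝ (dl (d.γ t.1.1 ⨯₃ d.γ t.1.2.2)) (dl_ne (d.cr _ _ (ne13 t))) := rfl

theorem sup_eq (x z : Circle) : (ξ₁ x).submodule ⊔ (ξ₁ z).submodule =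
    Submodule.span ℝ {d.γ x, d.γ z} := by
  rw [d.hξ₁, d.hξ₁, Projectivization.submodule_mk, Projectivization.submodule_mk,
    Submodule.span_insert]

theorem Φ_eq1 (t : T) : (d.Φ t).1.1.submodule =
    ((ξ₁ t.1.1).submodule ⊔ (ξ₁ t.1.2.2).submodule) ⊓ ξ₂ t.1.2.1 := by
  rw [Φ_fst, d.sup_eq, Projectivization.submodule_mk]
  apply le_antisymm
  · rw [Submodule.span_singleton_le_iff_mem, Submodule.mem_inf]
    exact ⟨Submodule.mem_span_pair.2 ⟨_, _, rfl⟩, (d.hξ₂ _ _).2 (d.n_pv _)⟩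
  · rintro v ⟨hv1, hv2⟩
    obtain ⟨a, b, rfl⟩ := Submodule.mem_span_pair.1 hv1
    have h0 := (d.hξ₂ _ _).1 hv2
    rw [dot_comb] at h0
    have hB := d.npos _ _ (pos_ne t.2).2.1.symm
    rw [Submodule.mem_span_singleton]
    refine ⟨a / (d.n t.1.2.1 ⬝ᵥ d.γ t.1.2.2), ?_⟩
    unfold pv
    rw [smul_add, smul_smul, smul_smul, div_mul_cancel₀ _ hB.ne']
    congr 2
    field_simp
    linarith

theorem Φ_eq2 (t : T) : (d.Φ t).1.2.submodule =
    ((ξ₁ t.1.1).submodule ⊔ (ξ₁ t.1.2.2).submodule).dualAnnihilator := by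
  rw [Φ_snd, d.sup_eq, Projectivization.submodule_mk]
  apply le_antisymm
  · rw [Submodule.span_singleton_le_iff_mem, Submodule.mem_dualAnnihilator]
    intro v hv
    obtain ⟨a, b, rfl⟩ := Submodule.mem_span_pair.1 hv
    rw [dl_apply, dot_comb, dot_cross1, dot_cross2]; simp
  · intro φ hφ
    rw [Submodule.mem_dualAnnihilator] at hφ
    obtain ⟨m, rfl⟩ := dl.surjective φ
    have h1 := hφ (d.γ t.1.1) (Submodule.subset_span (by simp))
    have h2 := hφ (d.γ t.1.2.2) (Submodule.subset_span (by simp))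
    rw [dl_apply] at h1 h2
    obtain ⟨a, rfl⟩ := cross_perp (d.cr _ _ (ne13 t)) h1 h2
    rw [Submodule.mem_span_singleton]
    exact ⟨a, by rw [map_smul]⟩

theorem fib (t t' : T) (h : d.Φ t = d.Φ t') :
    t = t' ∨ (t'.1.1 = t.1.2.2 ∧ t'.1.2.2 = t.1.1) := by
  have h1 : (d.Φ t).1.1 = (d.Φ t').1.1 := by rw [h]
  have h2 : (d.Φ t).1.2 = (d.Φ t').1.2 := by rw [h]
  rw [Φ_fst, Φ_fst] at h1
  rw [Φ_snd, Φ_snd, mk_dl_eq] at h2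
  obtain ⟨μ, hμ⟩ := h2
  have hx : t'.1.1 = t.1.1 ∨ t'.1.1 = t.1.2.2 := by
    by_contra hno
    push Not at hno
    apply d.det _ _ _ (Ne.symm hno.1) hno.2 (ne13 t)
    rw [← hμ, dotProduct_smul, dotProduct_comm, dot_cross1, smul_zero]
  have hz : t'.1.2.2 = t.1.1 ∨ t'.1.2.2 = t.1.2.2 := by
    by_contra hno
    push Not at hno
    apply d.det _ _ _ (Ne.symm hno.1) hno.2 (ne13 t)
    rw [← hμ, dotProduct_smul, dotProduct_comm, dot_cross2, smul_zero]
  have hne := ne13 t'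
  rcases hx with hx | hx
  · left
    have hz : t'.1.2.2 = t.1.2.2 := hz.resolve_left (fun h => hne (hx.trans h.symm))
    obtain ⟨a, ha⟩ := (Projectivization.mk_eq_mk_iff' _ _ _ _ _).1 h1
    have hy : t.1.2.1 = t'.1.2.1 := by
      have hp' := t'.2
      rw [hx, hz] at hp'
      refine d.uniq t.2 hp' (d.pv_sign t) (d.n_pv t.1) ?_
      change d.n t'.1.2.1 ⬝ᵥ d.pv t.1 = 0
      rw [← ha, dotProduct_smul, d.n_pv, smul_zero]
    exact Subtype.ext (Prod.ext hx.symm (Prod.ext hy hz.symm))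
  · right
    exact ⟨hx, hz.resolve_right (fun h => hne (hx.trans h.symm))⟩

theorem ex_rep (b : ↥(Omega2 C)) : ∃ p w : Fin 3 → ℝ, ∃ hp : p ≠ 0, ∃ hw : w ≠ 0,
    b.1 = (Projectivization.mk ℝ p hp, Projectivization.mk ℝ (dl w) (dl_ne hw)) ∧ w ⬝ᵥ p = 0 ∧
    Projectivization.mk ℝ p hp ∉ closure C ∧ ∃ c ∈ d.P, w ⬝ᵥ c = 0 := by
  obtain ⟨⟨p, l⟩, hF, hcl, q, hqC, hq⟩ := b
  induction p using Projectivization.ind with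
  | h p hp =>
    induction l using Projectivization.ind with
    | h l hl =>
      obtain ⟨w, rfl⟩ := dl.surjective l
      have hw : w ≠ 0 := by rintro rfl; simp at hl
      obtain ⟨c, hc, hc0, rfl⟩ := d.memC q hqC
      refine ⟨p, w, hp, hw, rfl, ?_, hcl, c, hc, ?_⟩
      · exact (flag_iff hp hl).1 hF
      · exact (flag_iff hc0 hl).1 hq

theorem ex_chord (b : ↥(Omega2 C)) : ∃ x z : Circle, x ≠ z ∧
    (∃ t : T, t.1.1 = x ∧ t.1.2.2 = z ∧ d.Φ t = b) ∧
    (∃ t : T, t.1.1 = z ∧ t.1.2.2 = x ∧ d.Φ t = b) := by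
  obtain ⟨p, w, hp, hw, hb, hwp, hcl, c, hc, hwc⟩ := d.ex_rep b
  obtain ⟨x, z, hxz, hx, hz⟩ := d.chord hc hwc hp hwp hcl
  have main : ∀ x z, x ≠ z → w ⬝ᵥ d.γ x = 0 → w ⬝ᵥ d.γ z = 0 →
      ∃ t : T, t.1.1 = x ∧ t.1.2.2 = z ∧ d.Φ t = b := by
    intro x z hxz hx hz
    obtain ⟨μ, hμ⟩ := cross_perp (d.cr x z hxz) hx hz
    have μ0 : μ ≠ 0 := by rintro rfl; simp at hμ; exact hw hμ
    have hNp : (d.γ x ⨯₃ d.γ z) ⬝ᵥ p = 0 := by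
      rw [hμ, smul_dotProduct, smul_eq_mul] at hwp
      exact (mul_eq_zero.1 hwp).resolve_left μ0
    obtain ⟨a, b', rfl⟩ := cross_span (d.cr x z hxz) hNp
    have hab := d.signs hxz hp hcl
    have gc : Continuous (fun y => d.n y ⬝ᵥ (a • d.γ x + b' • d.γ z)) :=
      dot_cont.comp (d.nc.prodMk continuous_const)
    obtain ⟨y, hpos, hy⟩ := arc_zero hxz _ gc (by
      simp only [dot_comb, d.nγ]
      have := mul_pos (d.npos x z hxz) (d.npos z x hxz.symm)
      nlinarith)
    have hB := d.npos _ _ (pos_ne hpos).2.1.symm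
    simp only [dot_comb] at hy
    refine ⟨⟨(x, y, z), hpos⟩, rfl, rfl, ?_⟩
    apply Subtype.ext
    rw [hb]
    refine Prod.ext ?_ ?_
    · rw [Φ_fst]
      symm
      rw [Projectivization.mk_eq_mk_iff']
      refine ⟨a / (d.n y ⬝ᵥ d.γ z), ?_⟩
      unfold pv
      rw [smul_add, smul_smul, smul_smul]
      simp only
      rw [div_mul_cancel₀ _ hB.ne']
      congr 2
      field_simp
      linarith
    · rw [Φ_snd]
      symm
      simp only
      rw [mk_dl_eq]
      exact ⟨μ, hμ.symm⟩
  exact ⟨x, z, hxz, main x z hxz hx hz, main z x hxz.symm hz hx⟩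

theorem Φ_cont : Continuous d.Φ := by
  refine Continuous.subtype_mk (Continuous.prodMk ?_ ?_) _
  · exact mk_cont (d.pv_cont.comp continuous_subtype_val) (fun t : T => d.pv_ne t.1 (ne13 t))
  · refine mk_cont (g := fun t : T => dl (d.γ t.1.1 ⨯₃ d.γ t.1.2.2)) ?_
      (fun t : T => dl_ne (d.cr _ _ (ne13 t)))
    refine dl_cont.comp (cross_cont.comp (Continuous.prodMk ?_ ?_))
    · exact d.γc.comp (by fun_prop)
    · exact d.γc.comp (by fun_prop)

theorem Φ_ncard (b : ↥(Omega2 C)) : (d.Φ ⁻¹' {b}).ncard = 2 := by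
  obtain ⟨x, z, hxz, ⟨t, h1, h2, h3⟩, ⟨t', h1', h2', h3'⟩⟩ := d.ex_chord b
  rw [Set.ncard_eq_two]
  refine ⟨t, t', ?_, ?_⟩
  · rintro rfl; exact hxz (h1.symm.trans h1')
  · ext s
    simp only [Set.mem_preimage, Set.mem_singleton_iff, Set.mem_insert_iff]
    constructor
    · intro hs
      rcases d.fib t s (h3.trans hs.symm) with h | h
      · exact Or.inl h.symm
      · rcases d.fib t' s (h3'.trans hs.symm) with h' | h'
        · exact Or.inr h'.symm
        · exact absurd ((h2'.symm.trans h'.1.symm).trans (h.1.trans h2)) hxz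
    · rintro (rfl | rfl)
      · exact h3
      · exact h3'

set_option maxHeartbeats 2000000 in
theorem Φ_proper : IsProperMap d.Φ := by
  rw [isProperMap_iff_ultrafilter]
  refine ⟨d.Φ_cont, ?_⟩
  intro 𝒰 b hb
  obtain ⟨⟨x, y, z⟩, -, hs⟩ := isCompact_univ.ultrafilter_le_nhds (𝒰.map Subtype.val) (by simp)
  have hs : Tendsto (Subtype.val : T → Circle × Circle × Circle) 𝒰 (𝓝 (x, y, z)) := hs
  have hx : Tendsto (fun t : T => t.1.1) 𝒰 (𝓝 x) := (continuous_fst.tendsto _).comp hs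
  have hz : Tendsto (fun t : T => t.1.2.2) 𝒰 (𝓝 z) :=
    ((continuous_snd.comp continuous_snd).tendsto _).comp hs
  obtain ⟨p, w, hp, hw, hbe, hwp, hcl, -⟩ := d.ex_rep b
  have hxz : x ≠ z := by
    rintro rfl
    let M : T → Fin 3 → ℝ := fun t => ‖d.γ t.1.1 ⨯₃ d.γ t.1.2.2‖⁻¹ • (d.γ t.1.1 ⨯₃ d.γ t.1.2.2)
    have hM1 : ∀ t, M t ∈ Metric.sphere (0 : Fin 3 → ℝ) 1 := by
      intro t
      have : ‖d.γ t.1.1 ⨯₃ d.γ t.1.2.2‖ ≠ 0 := norm_ne_zero_iff.2 (d.cr _ _ (ne13 t))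
      rw [mem_sphere_zero_iff_norm, norm_smul, norm_inv, norm_norm, inv_mul_cancel₀ this]
    obtain ⟨m, hm1, hm⟩ := (isCompact_sphere (0 : Fin 3 → ℝ) 1).ultrafilter_le_nhds (𝒰.map M) (by
      rw [le_principal_iff]; exact Filter.mem_map.2 (Filter.univ_mem' hM1))
    have hm : Tendsto M 𝒰 (𝓝 m) := hm
    have nz : ∀ v ∈ Metric.sphere (0 : Fin 3 → ℝ) 1, v ≠ 0 := by
      rintro v hv rfl; simp at hv
    have hm0 := nz m hm1
    have hlim : Tendsto (fun t : T => (d.Φ t).1.2) 𝒰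
        (𝓝 (Projectivization.mk ℝ (dl m) (dl_ne hm0))) := by
      have c1 : Continuous (fun v : {v : Fin 3 → ℝ // v ≠ 0} =>
          Projectivization.mk ℝ (dl v.1) (dl_ne v.2)) :=
        mk_cont (dl_cont.comp continuous_subtype_val) _
      have c2 : Tendsto (fun t : T => (⟨M t, nz _ (hM1 t)⟩ : {v : Fin 3 → ℝ // v ≠ 0})) 𝒰
          (𝓝 ⟨m, hm0⟩) := tendsto_subtype_rng.2 hm
      refine ((c1.tendsto _).comp c2).congr fun t => ?_
      rw [Φ_snd]
      simp only [Function.comp]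
      rw [mk_dl_eq]
      exact ⟨_, rfl⟩
    have hlim2 : Tendsto (fun t : T => (d.Φ t).1.2) 𝒰 (𝓝 b.1.2) :=
      ((continuous_snd.comp continuous_subtype_val).tendsto _).comp hb
    have hbm := tendsto_nhds_unique hlim hlim2
    obtain ⟨c, hc, hmc⟩ : ∃ c ∈ d.P, m ⬝ᵥ c = 0 := by
      obtain ⟨q, hqC, hq⟩ := b.2.2.2
      obtain ⟨c, hc, hc0, rfl⟩ := d.memC q hqC
      rw [← hbm, flag_iff] at hq
      exact ⟨c, hc, hq⟩
    have hMc : Tendsto (fun t => M t ⬝ᵥ c) 𝒰 (𝓝 0) := by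
      rw [← hmc]
      exact (dot_cont.tendsto (m, c)).comp (hm.prodMk_nhds tendsto_const_nhds)
    have hMM : Tendsto (fun t => M t ⬝ᵥ M t) 𝒰 (𝓝 (m ⬝ᵥ m)) :=
      (dot_cont.tendsto (m, m)).comp (hm.prodMk_nhds hm)
    have hmm : m ⬝ᵥ m ≠ 0 := by rwa [Ne, dotProduct_self_eq_zero]
    let ct : T → Fin 3 → ℝ := fun t => c - ((M t ⬝ᵥ c) / (M t ⬝ᵥ M t)) • M t
    have hct : Tendsto ct 𝒰 (𝓝 c) := by
      have h1 : Tendsto (fun t => (M t ⬝ᵥ c) / (M t ⬝ᵥ M t)) 𝒰 (𝓝 0) := by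
        have h0 := Tendsto.div hMc hMM hmm
        rw [zero_div] at h0
        exact h0
      have h2 : Tendsto (fun t => ((M t ⬝ᵥ c) / (M t ⬝ᵥ M t)) • M t) 𝒰 (𝓝 0) := by
        have h0 := Tendsto.smul h1 hm
        rw [zero_smul] at h0
        exact h0
      have h3 := Tendsto.sub (tendsto_const_nhds (x := c) (f := (𝒰 : Filter T))) h2
      rw [sub_zero] at h3
      exact h3
    have hin : ∀ᶠ t in (𝒰 : Filter T), ct t ∈ d.P := hct.eventually (d.hP.mem_nhds hc)
    have hfc : Continuous d.f := d.f.continuous_of_finiteDimensional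
    have hub : ∀ᶠ t in (𝒰 : Filter T), d.n x ⬝ᵥ ct t ≤
        d.f (ct t) * (d.n x ⬝ᵥ d.γ t.1.1 + d.n x ⬝ᵥ d.γ t.1.2.2) := by
      filter_upwards [hin] with t ht
      have hMt : M t ≠ 0 := nz _ (hM1 t)
      have hMMt : M t ⬝ᵥ M t ≠ 0 := by rwa [Ne, dotProduct_self_eq_zero]
      have h0 : M t ⬝ᵥ ct t = 0 := by
        simp only [ct, dotProduct_sub, dotProduct_smul, smul_eq_mul]
        rw [div_mul_cancel₀ _ hMMt, sub_self]
      have h1 : (d.γ t.1.1 ⨯₃ d.γ t.1.2.2) ⬝ᵥ ct t = 0 := by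
        simp only [M] at h0
        rw [smul_dotProduct, smul_eq_mul] at h0
        refine (mul_eq_zero.1 h0).resolve_left ?_
        exact inv_ne_zero (norm_ne_zero_iff.2 (d.cr _ _ (ne13 t)))
      obtain ⟨s, r, hsr⟩ := cross_span (d.cr _ _ (ne13 t)) h1
      have hr : 0 < r := by
        have := d.nP t.1.1 _ ht
        rw [hsr, dot_comb, d.nγ, mul_zero, zero_add] at this
        exact pos_of_mul_pos_left this (d.npos _ _ (ne13 t).symm).le
      have hs : 0 < s := by
        have := d.nP t.1.2.2 _ ht
        rw [hsr, dot_comb, d.nγ, mul_zero, add_zero] at this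
        exact pos_of_mul_pos_left this (d.npos _ _ (ne13 t)).le
      have nn : ∀ v, 0 ≤ d.n x ⬝ᵥ d.γ v := by
        intro v
        by_cases hyw : v = x
        · rw [hyw, d.nγ]
        · exact (d.npos v x hyw).le
      rw [hsr, dot_comb, map_add, map_smul, map_smul, d.fγ, d.fγ, smul_eq_mul, smul_eq_mul]
      have := mul_nonneg hs.le (nn t.1.2.2)
      have := mul_nonneg hr.le (nn t.1.1)
      nlinarith
    have gc : ∀ h : T → Circle, Tendsto h 𝒰 (𝓝 x) →
        Tendsto (fun t => d.n x ⬝ᵥ d.γ (h t)) 𝒰 (𝓝 0) := by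
      intro h hh
      rw [← d.nγ x]
      exact (dot_cont.tendsto (d.n x, d.γ x)).comp
        (tendsto_const_nhds.prodMk_nhds ((d.γc.tendsto x).comp hh))
    have l1 : Tendsto (fun t => d.n x ⬝ᵥ ct t) 𝒰 (𝓝 (d.n x ⬝ᵥ c)) :=
      (dot_cont.tendsto (d.n x, c)).comp (tendsto_const_nhds.prodMk_nhds hct)
    have l2 := ((hfc.tendsto c).comp hct).mul ((gc _ hx).add (gc _ hz))
    have := le_of_tendsto_of_tendsto l1 l2 hub
    have h3 := d.nP x c hc
    simp at this
    linarith
  -- first component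
  have hfst : b.1.1 = Projectivization.mk ℝ (d.pv (x, y, z)) (d.pv_ne (x, y, z) hxz) := by
    have c1 : Continuous (fun t : {t : Circle × Circle × Circle // t.1 ≠ t.2.2} =>
        Projectivization.mk ℝ (d.pv t.1) (d.pv_ne t.1 t.2)) :=
      mk_cont (d.pv_cont.comp continuous_subtype_val) _
    have c2 : Tendsto (fun t : T =>
        (⟨t.1, ne13 t⟩ : {t : Circle × Circle × Circle // t.1 ≠ t.2.2})) 𝒰
        (𝓝 ⟨(x, y, z), hxz⟩) := tendsto_subtype_rng.2 hs
    have l1 := (c1.tendsto _).comp c2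
    have l2 : Tendsto (fun t : T => (d.Φ t).1.1) 𝒰 (𝓝 b.1.1) :=
      ((continuous_fst.comp continuous_subtype_val).tendsto _).comp hb
    exact tendsto_nhds_unique l2 l1
  have hbcl : b.1.1 ∉ closure C := b.2.2.1
  have hxy : x ≠ y := by
    rintro rfl
    apply hbcl
    have : b.1.1 = Projectivization.mk ℝ (d.γ x) (d.γ0 x) := by
      rw [hfst, Projectivization.mk_eq_mk_iff']
      exact ⟨d.n x ⬝ᵥ d.γ z, by simp [pv, d.nγ]⟩
    rw [this]; exact d.γcl x
  have hyz : y ≠ z := by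
    rintro rfl
    apply hbcl
    have : b.1.1 = Projectivization.mk ℝ (d.γ y) (d.γ0 y) := by
      rw [hfst, Projectivization.mk_eq_mk_iff']
      exact ⟨-(d.n y ⬝ᵥ d.γ x), by simp [pv, d.nγ]⟩
    rw [this]; exact d.γcl y
  have hpos : PosOriented x y z := by
    apply pos_of_D hxy hyz hxz
    have l := (D_cont.tendsto (x, y, z)).comp hs
    exact ge_of_tendsto' l fun t => (D_pos t.2).le
  have hle : (𝒰 : Filter T) ≤ 𝓝 ⟨(x, y, z), hpos⟩ := by
    have : Tendsto (id : T → T) 𝒰 (𝓝 ⟨(x, y, z), hpos⟩) := tendsto_subtype_rng.2 hs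
    exact this
  refine ⟨⟨(x, y, z), hpos⟩, ?_, hle⟩
  exact tendsto_nhds_unique ((d.Φ_cont.tendsto _).mono_left hle) hb

theorem Φ_covering : IsCoveringMap d.Φ := by
  refine covering_aux d.Φ_cont d.Φ_proper.isClosedMap d.Φ_ncard ?_
  intro b
  obtain ⟨x, z, hxz, ⟨t, h1, h2, h3⟩, -⟩ := d.ex_chord b
  obtain ⟨A, B, hA, hB, hxA, hzB, hAB⟩ := t2_separation hxz
  have hd : ∀ w, w ∈ A → w ∉ B := fun w h h' => Set.disjoint_left.1 hAB h h'
  have cx : Continuous (fun t : T => t.1.1) := by fun_prop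
  have cz : Continuous (fun t : T => t.1.2.2) := by fun_prop
  refine ⟨{t | t.1.1 ∈ A ∧ t.1.2.2 ∈ B}, {t | t.1.1 ∈ B ∧ t.1.2.2 ∈ A},
    (hA.preimage cx).inter (hB.preimage cz), (hB.preimage cx).inter (hA.preimage cz), ?_, ?_,
    ?_, ?_⟩
  · rw [Set.disjoint_left]
    rintro s ⟨ha, -⟩ ⟨hb, -⟩
    exact hd _ ha hb
  · intro s hs
    have hs : d.Φ s = b := hs
    rcases d.fib t s (h3.trans hs.symm) with h | h
    · left
      rw [← h]
      exact ⟨by rw [h1]; exact hxA, by rw [h2]; exact hzB⟩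
    · right
      exact ⟨by rw [h.1, h2]; exact hzB, by rw [h.2, h1]; exact hxA⟩
  · rintro s ⟨ha, hb⟩ s' ⟨ha', hb'⟩ h
    rcases d.fib s s' h with h | h
    · exact h
    · rw [h.1] at ha'
      exact absurd hb (hd _ ha')
  · rintro s ⟨ha, hb⟩ s' ⟨ha', hb'⟩ h
    rcases d.fib s s' h with h | h
    · exact h
    · rw [h.1] at ha'
      exact absurd ha' (hd _ hb)

end Dat

end Part4

/-- The map `Φ_tr(x,y,z) = (ℙ((x¹ + z¹) ∩ ξ²(y)), x¹ + z¹)` on the space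
`T⁺` of positively oriented triples is well defined, lands in `Ω²`, its image is exactly `Ω²`
(surjectivity), and it is a two-sheeted covering map onto `Ω²`. -/
theorem statement_12
    (C : Set (ℙ ℝ (Fin 3 → ℝ))) (hCopen : IsOpen C) (hCpc : ProperlyConvex C)
    (hstrict : StrictlyConvexBoundary C)
    (hC1 : ∀ p ∈ frontier C, ∃! W : Submodule ℝ (Fin 3 → ℝ), IsSupportingLineAt C W p)
    (ξ₁ : Circle → ℙ ℝ (Fin 3 → ℝ))
    (hξ₁ : ∃ e : Circle ≃ₜ frontier C, ∀ x, (e x : ℙ ℝ (Fin 3 → ℝ)) = ξ₁ x)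
    (ξ₂ : Circle → Submodule ℝ (Fin 3 → ℝ))
    (hξ₂ : ∀ x, IsSupportingLineAt C (ξ₂ x) (ξ₁ x)) :
    ∃ Φ : {t : Circle × Circle × Circle // PosOriented t.1 t.2.1 t.2.2} → ↥(Omega2 C),
      (∀ t, (Φ t : ℙ ℝ (Fin 3 → ℝ) × ℙ ℝ (Module.Dual ℝ (Fin 3 → ℝ))).1.submodule =
          ((ξ₁ t.1.1).submodule ⊔ (ξ₁ t.1.2.2).submodule) ⊓ ξ₂ t.1.2.1) ∧
      (∀ t, (Φ t : ℙ ℝ (Fin 3 → ℝ) × ℙ ℝ (Module.Dual ℝ (Fin 3 → ℝ))).2.submodule =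
          ((ξ₁ t.1.1).submodule ⊔ (ξ₁ t.1.2.2).submodule).dualAnnihilator) ∧
      Function.Surjective Φ ∧
      IsCoveringMap Φ ∧
      (∀ b, (Φ ⁻¹' {b}).ncard = 2) := by
  obtain ⟨d⟩ := exists_dat C hCopen hCpc hstrict hC1 ξ₁ hξ₁ ξ₂ hξ₂
  refine ⟨d.Φ, d.Φ_eq1, d.Φ_eq2, ?_, d.Φ_covering, d.Φ_ncard⟩
  intro b
  obtain ⟨x, z, hxz, ⟨t, h1, h2, h3⟩, -⟩ := d.ex_chord b
  exact ⟨t, h3⟩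

end CFF
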